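/- With P = k[x,y,z,w], Φ a degree-3 Macaulay inverse system, ann Φ containing no nonzero linear form, p bijective, and the symmetric matrix SM of rank exactly 1, the ideal ann Φ is the sum of two linked grade-three perfect ideals: there exist ideals I₁ and I₂ of P and elements a₁,a₂,a₃ ∈ I₁ ∩ I₂ forming a regular sequence on P, such that (a₁,a₂,a₃) : I₁ = I₂, (a₁,a₂,a₃) : I₂ = I₁, ann Φ = I₁ + I₂, and each of P/I₁ and P/I₂ admits a free resolution of length three by finitely generated free P-modules. -/

import Mathlib

open MvPolynomial

noncomputable section

variable (k : Type*) [Field k]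

/-- The annihilator ideal `ann Φ = {f : Φ(f·g) = 0 for all g}` of the
linear functional `Φ`. -/
def annIdeal (Φ : MvPolynomial (Fin 4) k →ₗ[k] k) : Ideal (MvPolynomial (Fin 4) k) where
  carrier := {f | ∀ g, Φ (f * g) = 0}
  add_mem' := by
    intro a b ha hb g
    rw [add_mul, map_add, ha g, hb g, add_zero]
  zero_mem' := by intro g; simp
  smul_mem' := by
    intro c a ha g
    have h : c • a * g = a * (c * g) := by rw [smul_eq_mul]; ring
    rw [h]; exact ha (c * g)

/-- The Macaulay map `p : P₁ → Hom(P₁, k)`, `p(u)(v) = Φ(x·u·v)`. -/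
def pMap (Φ : MvPolynomial (Fin 4) k →ₗ[k] k) :
    homogeneousSubmodule (Fin 4) k 1 →ₗ[k]
      (homogeneousSubmodule (Fin 4) k 1 →ₗ[k] k) where
  toFun u :=
    { toFun := fun v => Φ (X 0 * u.1 * v.1)
      map_add' := fun v w => by simp [mul_add]
      map_smul' := fun c v => by simp [mul_smul_comm] }
  map_add' u u' := by
    ext v
    simp [add_mul, mul_add]
  map_smul' c u := by
    ext v
    simp [mul_smul_comm, smul_mul_assoc]

/-- The symmetric `3 × 3` matrix `SM` of (6.3), built from the Macaulay inverse
system `Φ` and the linear forms `ℓ_q` (`p⁻¹(q·Φ)` for the quadrics `q`);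
here `⟨q,q'⟩ = Φ(q·ℓ_{q'})`. -/
def smMatrix (Φ : MvPolynomial (Fin 4) k →ₗ[k] k)
    (ly2 lyz lyw lz2 lzw lw2 : MvPolynomial (Fin 4) k) : Matrix (Fin 3) (Fin 3) k :=
  !![Φ (X 2 ^ 2 * lw2) - Φ (X 2 * X 3 * lzw),
      Φ (X 2 * X 3 * lyw) - Φ (X 2 * X 1 * lw2),
      Φ (X 1 * X 2 * lzw) - Φ (X 2 ^ 2 * lyw);
    Φ (X 1 * X 3 * lzw) - Φ (X 1 * X 2 * lw2),
      Φ (X 1 ^ 2 * lw2) - Φ (X 1 * X 3 * lyw),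
      Φ (X 1 * X 2 * lyw) - Φ (X 1 ^ 2 * lzw);
    Φ (X 1 * X 2 * lzw) - Φ (X 1 * X 3 * lz2),
      Φ (X 1 * X 3 * lyz) - Φ (X 1 ^ 2 * lzw),
      Φ (X 1 ^ 2 * lz2) - Φ (X 1 * X 2 * lyz)]

/-- `R/I` admits a free resolution of length three by finitely generated free
`R`-modules:  `0 → R^{n₃} → R^{n₂} → R^{n₁} → R` with the image of the last
map equal to `I`. -/
def HasLengthThreeFreeResolution {R : Type*} [CommRing R] (I : Ideal R) : Prop :=
  ∃ (n₁ n₂ n₃ : ℕ)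
    (d₃ : (Fin n₃ → R) →ₗ[R] (Fin n₂ → R))
    (d₂ : (Fin n₂ → R) →ₗ[R] (Fin n₁ → R))
    (d₁ : (Fin n₁ → R) →ₗ[R] R),
    Function.Injective d₃ ∧ LinearMap.range d₃ = LinearMap.ker d₂ ∧
      LinearMap.range d₂ = LinearMap.ker d₁ ∧ LinearMap.range d₁ = I

section core
variable {R : Type*} [CommRing R] [IsDomain R]

theorem core_syz1 {w ℓ u v x a0 a1 a2 s : R}
    (hw : w ≠ 0) (hℓ : Prime ℓ) (hu : ¬ ℓ ∣ u)
    (hP : ∀ f, (∃ a b, f * (-a0 * x^2 + u*x*a2 + v*x*a1 + ℓ*a1*a2 + w*s) = a*ℓ+b*u) →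
       ∃ a b, f = a*ℓ+b*u)
    (hB : ∀ c d, w ∣ c * (u*v+ℓ*a0) + d * (u*x+ℓ*a1) →
      ∃ t, w ∣ c - t * (u*x+ℓ*a1) ∧ w ∣ d + t * (u*v+ℓ*a0))
    {α β γ δ ε : R}
    (h : α*(w*ℓ)+β*(w*u)+γ*(u*v+ℓ*a0)+δ*(u*x+ℓ*a1)
      + ε*(-a0 * x^2 + u*x*a2 + v*x*a1 + ℓ*a1*a2 + w*s) = 0) :
    ∃ c1 c2 c3 c4 c5 c6, α = c1*u-a0*c2-a1*c3-s*c4 ∧ β = -c1*ℓ-v*c2-x*c3-s*c5 ∧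
      γ = w*c2+x^2*c4-x*a1*c5+(u*x+ℓ*a1)*c6 ∧
      δ = w*c3-(x*v+ℓ*a2)*c4+(x*a0-u*a2)*c5-(u*v+ℓ*a0)*c6 ∧ ε = ℓ*c4+u*c5 := by
  obtain ⟨c4, c5, rfl⟩ := hP ε ⟨-(α*w+γ*a0+δ*a1), -(β*w+γ*v+δ*x), by linear_combination h⟩
  obtain ⟨t, ⟨c2, h2⟩, ⟨c3, h3⟩⟩ := hB (γ - c4*x^2+c5*x*a1)
    (δ + c4*(x*v+ℓ*a2)-c5*(x*a0-u*a2))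
    ⟨-((α+s*c4)*ℓ+(β+s*c5)*u), by linear_combination h⟩
  have e : (α+s*c4+c2*a0+c3*a1)*ℓ+(β+s*c5+c2*v+c3*x)*u = 0 := by
    apply mul_left_cancel₀ hw
    linear_combination h - (u*v+ℓ*a0)*h2 - (u*x+ℓ*a1)*h3
  have : ℓ ∣ (β+s*c5+c2*v+c3*x) := by
    refine (hℓ.dvd_or_dvd (b := u) ⟨-(α+s*c4+c2*a0+c3*a1), by linear_combination e⟩).resolve_right hu
  obtain ⟨c1, hc1⟩ := this
  refine ⟨-c1, c2, c3, c4, c5, t, ?_, ?_, ?_, ?_, ?_⟩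
  · apply mul_left_cancel₀ hℓ.ne_zero
    linear_combination e - u*hc1
  · linear_combination hc1
  · linear_combination h2
  · linear_combination h3
  · ring

theorem core_syz2 {w ℓ u v x a0 a1 a2 s : R}
    (hw : Prime w) (hℓ : Prime ℓ) (hu : ¬ ℓ ∣ u) (hwq : ¬ w ∣ (u*v+ℓ*a0))
    {c1 c2 c3 c4 c5 c6 : R} (e1 : 0 = c1*u-a0*c2-a1*c3-s*c4) 
    (e3 : 0 = w*c2+x^2*c4-x*a1*c5+(u*x+ℓ*a1)*c6)
    (e4 : 0 = w*c3-(x*v+ℓ*a2)*c4+(x*a0-u*a2)*c5-(u*v+ℓ*a0)*c6) (e5 : 0 = ℓ*c4+u*c5) :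
    ∃ t t', c1 = t*s+t'*(a0*x-v*a1) ∧ c2 = t'*(u*x+ℓ*a1) ∧ c3 = -t'*(u*v+ℓ*a0) ∧
      c4 = t*u ∧ c5 = -t*ℓ ∧ c6 = -t*x-t'*w := by
  have : ℓ ∣ c5 := by
    refine (hℓ.dvd_or_dvd (b := u) ⟨-c4, by linear_combination -e5⟩).resolve_right hu
  obtain ⟨t, rfl⟩ := this
  have h4 : c4 = -t*u := by
    apply mul_left_cancel₀ hℓ.ne_zero
    linear_combination -e5
  subst h4
  have : w ∣ (c6 - t*x) := by
    refine (hw.dvd_or_dvd (b := (u*v+ℓ*a0)) ⟨c3, by linear_combination e4⟩).resolve_right hwq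
  obtain ⟨t', h6⟩ := this
  have h2 : c2 = -t'*(u*x+ℓ*a1) := by
    apply mul_left_cancel₀ hw.ne_zero
    linear_combination -e3 - (u*x+ℓ*a1)*h6
  have h3 : c3 = t'*(u*v+ℓ*a0) := by
    apply mul_left_cancel₀ hw.ne_zero
    linear_combination -e4 + (u*v+ℓ*a0)*h6
  have hu0 : u ≠ 0 := by rintro rfl; exact hu (dvd_zero _)
  refine ⟨-t, -t', ?_, h2, ?_, ?_, ?_, ?_⟩
  · apply mul_left_cancel₀ hu0
    linear_combination -e1 + a0*h2+a1*h3
  · rw [h3]; ring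
  · ring
  · ring
  · linear_combination h6

theorem core_res {w ℓ u v x a0 a1 a2 s : R}
    (hw : Prime w) (hℓ : Prime ℓ) (hu : ¬ ℓ ∣ u) (hwq : ¬ w ∣ (u*v+ℓ*a0))
    (hP : ∀ f, (∃ a b, f * (-a0 * x^2 + u*x*a2 + v*x*a1 + ℓ*a1*a2 + w*s) = a*ℓ+b*u) →
       ∃ a b, f = a*ℓ+b*u)
    (hB : ∀ c d, w ∣ c * (u*v+ℓ*a0) + d * (u*x+ℓ*a1) →
      ∃ t, w ∣ c - t * (u*x+ℓ*a1) ∧ w ∣ d + t * (u*v+ℓ*a0)) :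
    HasLengthThreeFreeResolution (Ideal.span {w*ℓ, w*u, u*v+ℓ*a0, u*x+ℓ*a1,
      -a0 * x^2 + u*x*a2 + v*x*a1 + ℓ*a1*a2 + w*s}) := by
  have hu0 : u ≠ 0 := by rintro rfl; exact hu (dvd_zero _)
  refine ⟨5, 6, 2, Matrix.mulVecLin !![s, a0*x-v*a1; 0, u*x+ℓ*a1; 0, -(u*v+ℓ*a0); u, 0; -ℓ, 0; -x, -w],
    Matrix.mulVecLin !![u, -a0, -a1, -s, 0, 0; -ℓ, -v, -x, 0, -s, 0;
      0, w, 0, x^2, -(x*a1), u*x+ℓ*a1; 0, 0, w, -(x*v+ℓ*a2), x*a0-u*a2, -(u*v+ℓ*a0);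
      0, 0, 0, ℓ, u, 0],
    Fintype.linearCombination R ![w*ℓ, w*u, u*v+ℓ*a0, u*x+ℓ*a1,
      -a0 * x^2 + u*x*a2 + v*x*a1 + ℓ*a1*a2 + w*s], ?_, ?_, ?_, ?_⟩
  · rw [← LinearMap.ker_eq_bot, LinearMap.ker_eq_bot']
    intro m hm
    have h1 := congrFun hm 3
    have h2 := congrFun hm 5
    simp [Matrix.mulVec, dotProduct, Fin.sum_univ_succ, hu0] at h1 h2
    simp [h1, hw.ne_zero] at h2
    ext i; fin_cases i <;> simp [h1, h2]
  · ext c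
    simp only [LinearMap.mem_range, LinearMap.mem_ker]
    constructor
    · rintro ⟨t, rfl⟩
      ext i; fin_cases i <;> simp [Matrix.mulVec, dotProduct, Fin.sum_univ_succ] <;> ring
    · intro hc
      have h0 := congrFun hc 0
      have h2 := congrFun hc 2
      have h3 := congrFun hc 3
      have h4 := congrFun hc 4
      simp [Matrix.mulVec, dotProduct, Fin.sum_univ_succ] at h0 h2 h3 h4
      obtain ⟨t, t', g0, g1, g2, g3, g4, g5⟩ := core_syz2 (w := w) (ℓ := ℓ) (u := u) (v := v)
        (x := x) (a0 := a0) (a1 := a1) (a2 := a2) (s := s) hw hℓ hu hwq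
        (c1 := c 0) (c2 := c 1) (c3 := c 2) (c4 := c 3) (c5 := c 4) (c6 := c 5)
        (by linear_combination -h0) (by linear_combination -h2) (by linear_combination -h3)
        (by linear_combination -h4)
      refine ⟨![t, t'], ?_⟩
      ext i; fin_cases i <;> simp [Matrix.mulVec, dotProduct, Fin.sum_univ_succ, g0, g1, g2, g3, g4, g5] <;> ring
  · ext c
    simp only [LinearMap.mem_range, LinearMap.mem_ker]
    constructor
    · rintro ⟨t, rfl⟩
      simp [Fintype.linearCombination_apply, Matrix.mulVec, dotProduct, Fin.sum_univ_succ]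
      ring
    · intro hc
      simp [Fintype.linearCombination_apply, Fin.sum_univ_succ] at hc
      obtain ⟨c1, c2, c3, c4, c5, c6, g0, g1, g2, g3, g4⟩ := core_syz1 hw.ne_zero hℓ hu hP hB
        (α := c 0) (β := c 1) (γ := c 2) (δ := c 3) (ε := c 4) (by linear_combination hc)
      refine ⟨![c1, c2, c3, c4, c5, c6], ?_⟩
      ext i; fin_cases i <;> simp [Matrix.mulVec, dotProduct, Fin.sum_univ_succ, g0, g1, g2, g3, g4] <;> ring
  · rw [Fintype.range_linearCombination]
    simp only [Matrix.range_cons, Matrix.range_empty, Set.union_empty, Set.singleton_union]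

theorem mem_span3 {a b c m : R} : m ∈ Ideal.span {a, b, c} ↔ ∃ α β γ, m = α*a+β*b+γ*c := by
  simp only [Ideal.mem_span_insert, Ideal.mem_span_singleton']
  constructor
  · rintro ⟨α, _, ⟨β, _, ⟨γ, rfl⟩, rfl⟩, rfl⟩
    exact ⟨α, β, γ, by ring⟩
  · rintro ⟨α, β, γ, rfl⟩
    exact ⟨α, _, ⟨β, _, ⟨γ, rfl⟩, rfl⟩, by ring⟩

theorem mem_span5 {a b c d e m : R} : m ∈ Ideal.span {a, b, c, d, e} ↔
    ∃ α β γ δ ε, m = α*a+β*b+γ*c+δ*d+ε*e := by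
  simp only [Ideal.mem_span_insert, Ideal.mem_span_singleton']
  constructor
  · rintro ⟨α, _, ⟨β, _, ⟨γ, _, ⟨δ, _, ⟨ε, rfl⟩, rfl⟩, rfl⟩, rfl⟩, rfl⟩
    exact ⟨α, β, γ, δ, ε, by ring⟩
  · rintro ⟨α, β, γ, δ, ε, rfl⟩
    exact ⟨α, _, ⟨β, _, ⟨γ, _, ⟨δ, _, ⟨ε, rfl⟩, rfl⟩, rfl⟩, rfl⟩, by ring⟩

theorem core_colon {w ℓ u v x a0 a1 a2 s : R}
    (hw : Prime w) (hℓ : Prime ℓ) (hu : ¬ ℓ ∣ u)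
    (hP : ∀ f, (∃ a b, f * (-a0 * x^2 + u*x*a2 + v*x*a1 + ℓ*a1*a2 + w*s) = a*ℓ+b*u) →
       ∃ a b, f = a*ℓ+b*u)
    (hB : ∀ c d, w ∣ c * (u*v+ℓ*a0) + d * (u*x+ℓ*a1) →
      ∃ t, w ∣ c - t * (u*x+ℓ*a1) ∧ w ∣ d + t * (u*v+ℓ*a0))
    (hvx : ∀ f, (∃ a b c, f * s = a*ℓ+b*v+c*x) → ∃ a b c, f = a*ℓ+b*v+c*x)
    (hv : ∀ f, (∃ a b, f * x = a*ℓ+b*v) → ∃ a b, f = a*ℓ+b*v) :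
    (Ideal.span {w*ℓ, u*v+ℓ*a0, -a0 * x^2 + u*x*a2 + v*x*a1 + ℓ*a1*a2 + w*s}).colon 
      (Ideal.span {w*ℓ, w*u, u*v+ℓ*a0, u*x+ℓ*a1,
      -a0 * x^2 + u*x*a2 + v*x*a1 + ℓ*a1*a2 + w*s} : Ideal R) = 
      Ideal.span {w*ℓ, w*v, u*v+ℓ*a0, v*x+ℓ*a2,
      -a0 * x^2 + u*x*a2 + v*x*a1 + ℓ*a1*a2 + w*s} := by
  ext f
  rw [Submodule.mem_colon]
  constructor
  · intro hf
    have h1 := hf (u*x+ℓ*a1) (Ideal.subset_span (by simp))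
    rw [smul_eq_mul, mem_span3] at h1
    obtain ⟨α, γ, ε, h1⟩ := h1
    obtain ⟨c1, c2, c3, c4, c5, c6, g0, g1, g2, g3, g4⟩ := core_syz1 hw.ne_zero hℓ hu hP hB
        (α := α) (β := 0) (γ := γ) (δ := -f) (ε := ε) (by linear_combination -h1)
    obtain ⟨p, q, t, ht⟩ := hvx c5 ⟨-c1, -c2, -c3, by linear_combination g1⟩
    obtain ⟨p', q', ht'⟩ := hv (c3 + s*t) ⟨-c1-s*p, -c2-s*q, by linear_combination g1-s*ht⟩
    rw [mem_span5]
    refine ⟨-p', -q', c6-p*x+q*a2, c4+p*u-q*a0-t*a1, t, ?_⟩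
    linear_combination -g3 - (x*a0-u*a2)*ht - w*ht'
  · intro hf p hp
    rw [mem_span5] at hf
    obtain ⟨f1, f2, f3, f4, f5, hf⟩ := hf
    obtain ⟨p1, p2, p3, p4, p5, hp⟩ := mem_span5.1 hp
    rw [smul_eq_mul, mem_span3]
    refine ⟨f1*p+(f2*(w*v)+f4*(v*x+ℓ*a2))*p1 - f2*p2*w*a0+f2*p4*(a1*v-x*a0)+f4*p2*(a2*u-x*a0)-f4*p4*s, 
      f3*p+(f2*(w*v)+f4*(v*x+ℓ*a2))*p3+f2*p2*w^2+f2*p4*(w*x)+f4*p2*(w*x)+f4*p4*x^2,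
      f5*p+(f2*(w*v)+f4*(v*x+ℓ*a2))*p5+f4*p4*ℓ, ?_⟩
    linear_combination p*hf + (f2*(w*v)+f4*(v*x+ℓ*a2))*hp

theorem core_reg {w ℓ u v x a0 a1 a2 s : R}
    (hw : Prime w) (hℓ : Prime ℓ) (hu : ¬ ℓ ∣ u) (hv : ¬ ℓ ∣ v) (hwq : ¬ w ∣ (u*v+ℓ*a0))
    (hP : ∀ f, (∃ a b, f * (-a0 * x^2 + u*x*a2 + v*x*a1 + ℓ*a1*a2 + w*s) = a*ℓ+b*u) →
       ∃ a b, f = a*ℓ+b*u)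
    (hP' : ∀ f, (∃ a b, f * (-a0 * x^2 + u*x*a2 + v*x*a1 + ℓ*a1*a2 + w*s) = a*ℓ+b*v) →
       ∃ a b, f = a*ℓ+b*v)
    (huv : ∀ f, (∃ a b, f * u = a*ℓ+b*v) → ∃ a b, f = a*ℓ+b*v)
    (hB : ∀ c d, w ∣ c * (u*v+ℓ*a0) + d * (u*x+ℓ*a1) →
      ∃ t, w ∣ c - t * (u*x+ℓ*a1) ∧ w ∣ d + t * (u*v+ℓ*a0))
    (hB' : ∀ c d, w ∣ c * (u*v+ℓ*a0) + d * (v*x+ℓ*a2) →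
      ∃ t, w ∣ c - t * (v*x+ℓ*a2) ∧ w ∣ d + t * (u*v+ℓ*a0))
    (hprop : (1:R) ∉ Ideal.span {w*ℓ, u*v+ℓ*a0, -a0 * x^2 + u*x*a2 + v*x*a1 + ℓ*a1*a2 + w*s}) :
    RingTheory.Sequence.IsRegular R [w*ℓ, u*v+ℓ*a0, -a0 * x^2 + u*x*a2 + v*x*a1 + ℓ*a1*a2 + w*s] := by
  have hℓq : ∀ g, ℓ ∣ g * (u*v+ℓ*a0) → ℓ ∣ g := by
    intro g hg
    refine (hℓ.dvd_or_dvd hg).resolve_right fun h => ?_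
    have : ℓ ∣ u*v := by simpa using dvd_sub h (dvd_mul_right ℓ a0)
    exact (hℓ.dvd_or_dvd this).elim hu hv
  refine ⟨(RingTheory.Sequence.isWeaklyRegular_iff_Fin _ _).2 ?_, ?_⟩
  · intro i
    rw [isSMulRegular_quotient_iff_mem_of_smul_mem]
    fin_cases i
    · intro g
      simp [hw.ne_zero, hℓ.ne_zero]
    · intro g
      simp only [Fin.mk_one, Fin.coe_ofNat_eq_mod, List.length_cons, List.take_succ_cons,
        List.length_nil, Nat.one_mod, List.take_zero, Ideal.ofList_singleton, smul_eq_mul,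
        Ideal.mul_top, Ideal.mem_span_singleton', List.getElem_cons_succ, List.getElem_cons_zero,
        Nat.reduceAdd, Nat.reduceMod]
      rintro ⟨α, h⟩
      replace h : α*(w*ℓ) = (u*v+ℓ*a0)*g := h
      have : w ∣ g := (hw.dvd_or_dvd (a := u*v+ℓ*a0) ⟨α*ℓ, by linear_combination -h⟩).resolve_left hwq
      obtain ⟨g, rfl⟩ := this
      have h2 : ℓ*α = g*(u*v+ℓ*a0) := by
        apply mul_left_cancel₀ hw.ne_zero; linear_combination h
      obtain ⟨g, rfl⟩ := hℓq g ⟨α, h2.symm⟩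
      exact ⟨g, by ring⟩
    · intro g
      have : Ideal.ofList (List.take (2:ℕ) [w*ℓ, u*v+ℓ*a0, -a0 * x^2 + u*x*a2 + v*x*a1 + ℓ*a1*a2 + w*s])
        = Ideal.span {w*ℓ, u*v+ℓ*a0} := by
        simp [Ideal.ofList_cons, Ideal.span_insert]
      change _ • g ∈ Ideal.ofList (List.take (2:ℕ) _) • _ → g ∈ Ideal.ofList (List.take (2:ℕ) _) • _
      rw [this, smul_eq_mul, smul_eq_mul, Ideal.mul_top, Ideal.mem_span_pair, Ideal.mem_span_pair]
      simp only [Fin.mk_one, Fin.coe_ofNat_eq_mod, List.length_cons,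
        List.length_nil, List.getElem_cons_succ, List.getElem_cons_zero,
        Nat.reduceAdd, Nat.reduceMod, Fin.reduceFinMk]
      rintro ⟨α, β, h⟩
      replace h : α*(w*ℓ)+β*(u*v+ℓ*a0) = (-a0 * x^2 + u*x*a2 + v*x*a1 + ℓ*a1*a2 + w*s)*g := h
      obtain ⟨a, b, hg⟩ := hP g ⟨α*w+β*a0, β*v, by linear_combination -h⟩
      obtain ⟨a', b', hg'⟩ := hP' g ⟨α*w+β*a0, β*u, by linear_combination -h⟩
      obtain ⟨b1, b2, hb⟩ := huv b ⟨a'-a, b', by linear_combination hg'-hg⟩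
      obtain ⟨g', hgg⟩ : ∃ g', g' = a+b1*u-b2*a0 := ⟨_, rfl⟩
      have hg1 : g = ℓ*g'+b2*(u*v+ℓ*a0) := by linear_combination hg+u*hb-ℓ*hgg
      obtain ⟨β2, h2⟩ := hℓq (β - b2*(-a0 * x^2 + u*x*a2 + v*x*a1 + ℓ*a1*a2 + w*s)) 
        ⟨(-a0 * x^2 + u*x*a2 + v*x*a1 + ℓ*a1*a2 + w*s)*g'-α*w, by
        linear_combination h+(-a0 * x^2 + u*x*a2 + v*x*a1 + ℓ*a1*a2 + w*s)*hg1⟩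
      have h3 : α*w+β2*(u*v+ℓ*a0) = (-a0 * x^2 + u*x*a2 + v*x*a1 + ℓ*a1*a2 + w*s)*g' := by
        apply mul_left_cancel₀ hℓ.ne_zero
        linear_combination h+(-a0 * x^2 + u*x*a2 + v*x*a1 + ℓ*a1*a2 + w*s)*hg1-(u*v+ℓ*a0)*h2
      obtain ⟨t, _, ht⟩ := hB (-(x^2*g'+ℓ*β2)) ((v*x+ℓ*a2)*g') ⟨(α-s*g')*ℓ, by linear_combination -ℓ*h3⟩
      obtain ⟨t', _, m, ht'⟩ := hB' t g' (by convert ht using 1; ring)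
      exact ⟨m, b2-ℓ*t', by linear_combination -hg1-ℓ*ht'⟩
  · intro h
    apply hprop
    have : Ideal.ofList [w*ℓ, u*v+ℓ*a0, -a0 * x^2 + u*x*a2 + v*x*a1 + ℓ*a1*a2 + w*s]
        = Ideal.span {w*ℓ, u*v+ℓ*a0, -a0 * x^2 + u*x*a2 + v*x*a1 + ℓ*a1*a2 + w*s} := by
        simp [Ideal.ofList_cons, Ideal.span_insert]
    rw [this, smul_eq_mul, Ideal.mul_top] at h
    rw [← h]; trivial

structure Half (w ℓ u v x a0 a1 a2 s : R) : Prop where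
  hw : Prime w
  hℓ : Prime ℓ
  hu : ¬ ℓ ∣ u
  hwq : ¬ w ∣ (u*v+ℓ*a0)
  hP : ∀ f, (∃ a b, f * (-a0 * x^2 + u*x*a2 + v*x*a1 + ℓ*a1*a2 + w*s) = a*ℓ+b*u) →
       ∃ a b, f = a*ℓ+b*u
  hB : ∀ c d, w ∣ c * (u*v+ℓ*a0) + d * (u*x+ℓ*a1) →
      ∃ t, w ∣ c - t * (u*x+ℓ*a1) ∧ w ∣ d + t * (u*v+ℓ*a0)
  hux : ∀ f, (∃ a b c, f * s = a*ℓ+b*u+c*x) → ∃ a b c, f = a*ℓ+b*u+c*x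
  hx : ∀ f, (∃ a b, f * x = a*ℓ+b*u) → ∃ a b, f = a*ℓ+b*u
  huv : ∀ f, (∃ a b, f * v = a*ℓ+b*u) → ∃ a b, f = a*ℓ+b*u
  hprop : (1:R) ∉ Ideal.span {w*ℓ, u*v+ℓ*a0, -a0 * x^2 + u*x*a2 + v*x*a1 + ℓ*a1*a2 + w*s}

theorem core_main {w ℓ u v x a0 a1 a2 s : R} (h1 : Half w ℓ u v x a0 a1 a2 s)
    (h2 : Half w ℓ v u x a0 a2 a1 s) : 
    ∃ (I₁ I₂ : Ideal R) (b₁ b₂ b₃ : R),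
      b₁ ∈ I₁ ⊓ I₂ ∧ b₂ ∈ I₁ ⊓ I₂ ∧ b₃ ∈ I₁ ⊓ I₂ ∧
        RingTheory.Sequence.IsRegular R [b₁, b₂, b₃] ∧
        (Ideal.span {b₁, b₂, b₃}).colon I₁ = I₂ ∧
        (Ideal.span {b₁, b₂, b₃}).colon I₂ = I₁ ∧
        I₁ + I₂ = Ideal.span {w*ℓ, w*u, u*v+ℓ*a0, u*x+ℓ*a1,
          -a0 * x^2 + u*x*a2 + v*x*a1 + ℓ*a1*a2 + w*s} ⊔ Ideal.span {w*ℓ, w*v, u*v+ℓ*a0, v*x+ℓ*a2,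
          -a0 * x^2 + u*x*a2 + v*x*a1 + ℓ*a1*a2 + w*s} ∧
        HasLengthThreeFreeResolution I₁ ∧ HasLengthThreeFreeResolution I₂ := by
  have e1 : v*u+ℓ*a0 = u*v+ℓ*a0 := by ring
  have e2 : -a0 * x^2 + v*x*a1 + u*x*a2 + ℓ*a2*a1 + w*s = 
    -a0 * x^2 + u*x*a2 + v*x*a1 + ℓ*a1*a2 + w*s := by ring
  have hB' := h2.hB
  have hP' := h2.hP
  rw [e1] at hB'
  rw [e2] at hP'
  refine ⟨_, _, w*ℓ, u*v+ℓ*a0, -a0 * x^2 + u*x*a2 + v*x*a1 + ℓ*a1*a2 + w*s, ?_, ?_, ?_, 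
    core_reg h1.hw h1.hℓ h1.hu h2.hu h1.hwq h1.hP hP' h2.huv h1.hB hB' h1.hprop, 
    core_colon h1.hw h1.hℓ h1.hu h1.hP h1.hB h2.hux h2.hx, ?_, rfl, 
    core_res h1.hw h1.hℓ h1.hu h1.hwq h1.hP h1.hB, ?_⟩
  · exact ⟨Ideal.subset_span (by simp), Ideal.subset_span (by simp)⟩
  · exact ⟨Ideal.subset_span (by simp), Ideal.subset_span (by simp)⟩
  · exact ⟨Ideal.subset_span (by simp), Ideal.subset_span (by simp)⟩
  · have := core_colon h2.hw h2.hℓ h2.hu h2.hP h2.hB h1.hux h1.hx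
    rwa [e1, e2] at this
  · have := core_res h2.hw h2.hℓ h2.hu h2.hwq h2.hP h2.hB
    rwa [e1, e2] at this
end core

section polys
variable {k : Type*} [Field k]
local notation "P" => MvPolynomial (Fin 4) k

theorem prime_lin (i j : Fin 4) (hij : i ≠ j) (b : k) : Prime (X i + C b * X j : P) := by
  rw [← irreducible_iff_prime]
  have := irreducible_mul_X_add (1 : P) (C b * X j) i one_ne_zero (by simp)
    (by
      intro h
      have := vars_mul _ _ h
      simp at this
      exact hij this) isRelPrime_one_left
  simpa using this

theorem relprime_aux (α0 α1 α2 β0 β1 β2 σ : k)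
    (hN : ¬ (β1 = β2 * β0 ∧ α1 = α2 * β0 - β0^2 ∧ α0 = - β0 * σ)) :
    IsRelPrime (X 2 * X 0 + X 1 * (C β0 * X 0 + C β1 * X 1 + C β2 * X 2) : P)
     (X 2 * (X 2 - C σ * X 0) + X 1 * (C α0 * X 0 + C α1 * X 1 + C α2 * X 2)) := by
  have X0 : ∀ i, (X i : P) ≠ 0 := fun i => X_ne_zero i
  have key1 : ¬ (X 2 * X 0 + X 1 * (C β0 * X 0 + C β1 * X 1 + C β2 * X 2) : P) ∣ 
      (X 2 * (X 2 - C σ * X 0) + X 1 * (C α0 * X 0 + C α1 * X 1 + C α2 * X 2)) := by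
    rintro ⟨g, hg⟩
    have h1 := congrArg (aeval ![X 0, 0, X 2, X 3] : P →ₐ[k] P) hg
    simp [aeval_X, algebraMap_eq] at h1
    rw [mul_assoc] at h1
    have h2 := mul_left_cancel₀ (X0 2) h1
    have h3 := congrArg (aeval ![0, X 1, X 2, X 3] : P →ₐ[k] P) h2
    simp [aeval_X, algebraMap_eq] at h3
  set θ : P →ₐ[k] P := aeval ![X 0, X 1, - C β0 * X 1, X 3] with hθ
  have θL : θ (X 2 + C β0 * X 1) = 0 := by simp [hθ, algebraMap_eq]
  have θd : ∀ f, (X 2 + C β0 * X 1 : P) ∣ f → θ f = 0 := by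
    rintro _ ⟨g, rfl⟩
    rw [map_mul, θL, zero_mul]
  have pL := prime_lin (k := k) 2 1 (by decide) β0
  by_cases hb : β1 = β2 * β0
  · have hfac : (X 2 * X 0 + X 1 * (C β0 * X 0 + C β1 * X 1 + C β2 * X 2) : P) = 
      (X 2 + C β0 * X 1) * (X 0 + C β2 * X 1) := by
      rw [hb, C_mul]; ring
    rw [hfac]
    apply IsRelPrime.mul_left
    · rw [pL.irreducible.isRelPrime_iff_not_dvd]
      intro h
      have h1 := θd _ h
      have h2 : X 1 * (C (β0 * σ + α0) * X 0 + C (β0^2+α1-α2*β0) * X 1 : P) = 0 := by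
        rw [← h1]
        simp [hθ, algebraMap_eq]
        ring
      have h3 := (mul_eq_zero.1 h2).resolve_left (X0 1)
      have h4 := congrArg (eval ![1,0,0,0]) h3
      have h5 := congrArg (eval ![0,1,0,0]) h3
      simp at h4 h5
      exact hN ⟨hb, by linear_combination h5, by linear_combination h4⟩
    · rw [(prime_lin (k := k) 0 1 (by decide) β2).irreducible.isRelPrime_iff_not_dvd]
      rintro ⟨g, hg⟩
      have h3 := congrArg (aeval ![0, 0, X 2, X 3] : P →ₐ[k] P) hg
      simp [aeval_X, algebraMap_eq] at h3
  · have : Irreducible (X 2 * X 0 + X 1 * (C β0 * X 0 + C β1 * X 1 + C β2 * X 2) : P) := by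
      have := irreducible_mul_X_add (X 2 + C β0 * X 1 : P) (X 1 * (C β1 * X 1 + C β2 * X 2)) 0 pL.ne_zero 
        (by
          intro h
          have := vars_add_subset _ _ h
          simp only [Finset.mem_union] at this
          rcases this with h | h
          · simp at h
          · have := vars_mul _ _ h
            simp at this) 
        (by
          intro h
          have := vars_mul _ _ h
          simp only [Finset.mem_union] at this
          rcases this with h | h
          · simp at h
          have := vars_add_subset _ _ h
          simp only [Finset.mem_union] at this
          rcases this with h | h
          · have := vars_mul _ _ h
            simp at this
          · have := vars_mul _ _ h
            simp at this) 
        (by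
          rw [pL.irreducible.isRelPrime_iff_not_dvd]
          intro h
          have h1 := θd _ h
          have h2 : C (β1 - β2*β0) * X 1 * X 1 = (0 : P) := by
            rw [← h1]
            simp [hθ, algebraMap_eq]
            ring
          have h3 := congrArg (eval ![0,1,0,0]) h2
          simp at h3
          exact hb (sub_eq_zero.1 h3))
      convert this using 1
      ring
    rwa [this.isRelPrime_iff_not_dvd]


theorem sub_mem_of (I : Ideal P) (g : Fin 4 → P) (hg : ∀ i, X i - g i ∈ I) (f : P) :
    f - aeval g f ∈ I := by
  have : (Ideal.Quotient.mkₐ k I).comp (aeval g) = Ideal.Quotient.mkₐ k I := by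
    apply MvPolynomial.algHom_ext
    intro i
    simp only [AlgHom.comp_apply, aeval_X]
    exact ((Ideal.Quotient.mk_eq_mk_iff_sub_mem _ _).2 (hg i)).symm
  exact (Ideal.Quotient.mk_eq_mk_iff_sub_mem _ _).1 (congrArg (fun φ => φ f) this).symm

theorem kill1 {f : P} (h : (aeval ![X 0, 0, X 2, X 3] : P →ₐ[k] P) f = 0) : X 1 ∣ f := by
  have := sub_mem_of (Ideal.span {X 1}) ![X 0, 0, X 2, X 3] (by
    intro i; fin_cases i <;> simp [Ideal.mem_span_singleton]) f
  rw [h, sub_zero] at this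
  exact Ideal.mem_span_singleton.1 this

theorem kill3 {f : P} (h : (aeval ![X 0, X 1, X 2, 0] : P →ₐ[k] P) f = 0) : X 3 ∣ f := by
  have := sub_mem_of (Ideal.span {X 3}) ![X 0, X 1, X 2, 0] (by
    intro i; fin_cases i <;> simp [Ideal.mem_span_singleton]) f
  rw [h, sub_zero] at this
  exact Ideal.mem_span_singleton.1 this

theorem kill12 {f : P} (h : (aeval ![X 0, 0, 0, X 3] : P →ₐ[k] P) f = 0) :
    ∃ a b, f = a * X 1 + b * X 2 := by
  have := sub_mem_of (Ideal.span {X 1, X 2}) ![X 0, 0, 0, X 3] (by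
    intro i; fin_cases i <;> simp <;> exact Ideal.subset_span (by simp)) f
  rw [h, sub_zero, Ideal.mem_span_pair] at this
  obtain ⟨a, b, h⟩ := this
  exact ⟨a, b, h.symm⟩

theorem kill012 {f : P} (h : (aeval ![0, 0, 0, X 3] : P →ₐ[k] P) f = 0) :
    ∃ a b c, f = a * X 1 + b * X 2 + c * X 0 := by
  have := sub_mem_of (Ideal.span {X 1, X 2, X 0}) ![0, 0, 0, X 3] (by
    intro i; fin_cases i <;> simp <;> exact Ideal.subset_span (by simp)) f
  rw [h, sub_zero, mem_span3] at this
  exact this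

theorem half_std {a0 a1 a2 s v : P} {α0 α1 α2 α3 β0 β1 β2 β3 σ ε lam : k} (hε : ε ≠ 0)
    (hv : v = X 2 - C σ * X 0 + C ε * X 3)
    (h0 : a0 = C α0 * X 0 + C α1 * X 1 + C α2 * X 2 + C α3 * X 3)
    (h1 : a1 = C β0 * X 0 + C β1 * X 1 + C β2 * X 2 + C β3 * X 3)
    (hs : s = C lam * X 0 ^ 2 + (v - X 2)^2)
    (hN : ¬ (β1 = β2 * β0 ∧ α1 = α2 * β0 - β0^2 ∧ α0 = - β0 * σ)) :
    Half (X 3) (X 1) (X 2) v (X 0) a0 a1 a2 s := by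
  have q0 : (aeval ![X 0, X 1, X 2, 0] : P →ₐ[k] P) (X 2 * v + X 1 * a0) = 
     (X 2 * (X 2 - C σ * X 0) + X 1 * (C α0 * X 0 + C α1 * X 1 + C α2 * X 2)) := by
    simp [hv, h0, algebraMap_eq]
  have q1 : (aeval ![X 0, X 1, X 2, 0] : P →ₐ[k] P) (X 2 * X 0 + X 1 * a1) = 
     (X 2 * X 0 + X 1 * (C β0 * X 0 + C β1 * X 1 + C β2 * X 2)) := by
    simp [h1, algebraMap_eq]
  have rp := relprime_aux (k := k) α0 α1 α2 β0 β1 β2 σ hN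
  have q0n : (X 2 * (X 2 - C σ * X 0) + X 1 * (C α0 * X 0 + C α1 * X 1 + C α2 * X 2) : P) ≠ 0 := by
    intro h
    have := congrArg (eval ![0,0,1,0]) h
    simp at this
  have X0 : ∀ i, (X i : P) ≠ 0 := fun i => X_ne_zero i
  have Cε : (C ε : P) ≠ 0 := by simpa using hε
  have vne : (aeval ![X 0, 0, 0, X 3] : P →ₐ[k] P) v ≠ 0 := by
    intro h
    have := congrArg (eval ![0,0,0,1]) h
    simp [hv, algebraMap_eq] at this
    exact hε this
  have sne : (aeval ![0, 0, 0, X 3] : P →ₐ[k] P) s ≠ 0 := by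
    intro h
    have := congrArg (eval ![0,0,0,1]) h
    simp [hs, hv, algebraMap_eq] at this
    exact hε this
  refine ⟨X_prime, X_prime, ?_, ?_, ?_, ?_, ?_, ?_, ?_, ?_⟩
  · rintro ⟨g, hg⟩
    have := congrArg (eval ![0,0,1,0]) hg
    simp at this
  · rintro ⟨g, hg⟩
    have := congrArg (aeval ![X 0, X 1, X 2, 0] : P →ₐ[k] P) hg
    rw [q0] at this
    simp at this
    exact q0n this
  · rintro f ⟨a, b, hf⟩
    apply kill12
    have := congrArg (aeval ![X 0, 0, 0, X 3] : P →ₐ[k] P) hf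
    simp only [map_mul, map_add (aeval ![X 0, 0, 0, X 3] : P →ₐ[k] P) (a * X 1)] at this
    simp only [aeval_X, Matrix.cons_val, mul_zero, add_zero] at this
    refine (mul_eq_zero.1 this).resolve_right ?_
    intro h
    have := congrArg (eval ![0,0,0,1]) h
    simp [hs, hv, algebraMap_eq] at this
    exact hε this
  · rintro c d ⟨g, hg⟩
    have := congrArg (aeval ![X 0, X 1, X 2, 0] : P →ₐ[k] P) hg
    rw [map_add, map_mul, map_mul, q0, q1] at this
    simp only [map_mul, aeval_X, Matrix.cons_val, zero_mul] at this
    obtain ⟨t, ht⟩ : (X 2 * X 0 + X 1 * (C β0 * X 0 + C β1 * X 1 + C β2 * X 2) : P) ∣ 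
      (aeval ![X 0, X 1, X 2, 0] : P →ₐ[k] P) c := by
      apply rp.dvd_of_dvd_mul_right
      exact ⟨- (aeval ![X 0, X 1, X 2, 0] : P →ₐ[k] P) d, by linear_combination this⟩
    have ht' : (aeval ![X 0, X 1, X 2, 0] : P →ₐ[k] P) d = 
      - t * (X 2 * (X 2 - C σ * X 0) + X 1 * (C α0 * X 0 + C α1 * X 1 + C α2 * X 2)) := by
      have q1n : (X 2 * X 0 + X 1 * (C β0 * X 0 + C β1 * X 1 + C β2 * X 2) : P) ≠ 0 := by
        intro h
        have := congrArg (aeval ![X 0, 0, X 2, X 3] : P →ₐ[k] P) h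
        simp at this
      apply mul_left_cancel₀ q1n
      rw [ht] at this
      linear_combination this
    have idem : ∀ f, (aeval ![X 0, X 1, X 2, 0] : P →ₐ[k] P) ((aeval ![X 0, X 1, X 2, 0] : P →ₐ[k] P) f) = 
       (aeval ![X 0, X 1, X 2, 0] : P →ₐ[k] P) f := by
      intro f
      have : (aeval ![X 0, X 1, X 2, 0] : P →ₐ[k] P).comp (aeval ![X 0, X 1, X 2, 0] : P →ₐ[k] P) = 
        (aeval ![X 0, X 1, X 2, 0] : P →ₐ[k] P) := by
        apply MvPolynomial.algHom_ext
        intro i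
        fin_cases i <;> simp
      exact congrArg (fun φ => φ f) this
    refine ⟨t, kill3 ?_, kill3 ?_⟩
    · rw [map_sub, map_mul, q1, ← idem c, ht, map_mul]
      simp [algebraMap_eq]
      ring
    · rw [map_add, map_mul, q0, ← idem d, ht', map_mul]
      simp [algebraMap_eq]
  · rintro f ⟨a, b, c, hf⟩
    apply kill012
    have := congrArg (aeval ![0, 0, 0, X 3] : P →ₐ[k] P) hf
    simp only [map_mul, map_add] at this
    simp only [aeval_X, Matrix.cons_val, mul_zero, add_zero] at this
    exact (mul_eq_zero.1 this).resolve_right sne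
  · rintro f ⟨a, b, hf⟩
    apply kill12
    have := congrArg (aeval ![X 0, 0, 0, X 3] : P →ₐ[k] P) hf
    simp only [map_mul, map_add] at this
    simp only [aeval_X, Matrix.cons_val, mul_zero, add_zero] at this
    exact (mul_eq_zero.1 this).resolve_right (X0 0)
  · rintro f ⟨a, b, hf⟩
    apply kill12
    have := congrArg (aeval ![X 0, 0, 0, X 3] : P →ₐ[k] P) hf
    simp only [map_mul, map_add (aeval ![X 0, 0, 0, X 3] : P →ₐ[k] P) (a * X 1)] at this
    simp only [aeval_X, Matrix.cons_val, mul_zero, add_zero] at this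
    exact (mul_eq_zero.1 this).resolve_right vne
  · rw [mem_span3]
    rintro ⟨a, b, c, h⟩
    have := congrArg (eval ![0,0,0,0]) h
    simp [hv] at this

theorem Half.map {R S : Type*} [CommRing R] [CommRing S] [IsDomain R] [IsDomain S] (e : R ≃+* S) {w ℓ u v x a0 a1 a2 s : R}
    (h : Half w ℓ u v x a0 a1 a2 s) : 
    Half (e w) (e ℓ) (e u) (e v) (e x) (e a0) (e a1) (e a2) (e s) := by
  have dv : ∀ a b, e a ∣ e b ↔ a ∣ b := fun a b => map_dvd_iff e
  have sj := e.surjective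
  have inj := e.injective
  obtain ⟨h1, h2, h3, h4, h5, h6, h7, h8, h9, h10⟩ := h
  refine ⟨(MulEquiv.prime_iff e).2 h1, (MulEquiv.prime_iff e).2 h2, ?_, ?_, ?_, ?_, ?_, ?_, ?_, ?_⟩ <;>
    simp only [sj.forall, sj.exists, ← map_mul, ← map_add, ← map_neg, ← map_pow, ← map_sub, dv, 
      inj.eq_iff]
  · exact h3
  · exact h4
  · exact h5
  · exact h6
  · exact h7
  · exact h8
  · exact h9
  · rw [mem_span3]
    rintro ⟨a, b, c, h⟩
    apply h10
    rw [mem_span3]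
    obtain ⟨a, rfl⟩ := sj a
    obtain ⟨b, rfl⟩ := sj b
    obtain ⟨c, rfl⟩ := sj c
    refine ⟨a, b, c, inj ?_⟩
    rw [map_one, h]
    simp

theorem half_of (e : P ≃ₐ[k] P) {x y u w a0 a1 a2 s v : P} {α0 α1 α2 α3 β0 β1 β2 β3 σ ε lam : k} (hε : ε ≠ 0)
    (ex : e (X 0) = x) (ey : e (X 1) = y) (eu : e (X 2) = u) (ew : e (X 3) = w)
    (hv : v = u - C σ * x + C ε * w)
    (h0 : a0 = C α0 * x + C α1 * y + C α2 * u + C α3 * w)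
    (h1 : a1 = C β0 * x + C β1 * y + C β2 * u + C β3 * w)
    (hs : s = C lam * x ^ 2 + (v - u)^2)
    (hN : ¬ (β1 = β2 * β0 ∧ α1 = α2 * β0 - β0^2 ∧ α0 = - β0 * σ)) :
    Half w y u v x a0 a1 a2 s := by
  have eC : ∀ a : k, e (C a) = C a := fun a => e.commutes a
  have H := (half_std (k := k) (a2 := e.symm a2) (α3 := α3) (β3 := β3) (lam := lam) hε rfl rfl rfl rfl hN).map e.toRingEquiv
  simp only [AlgEquiv.toRingEquiv_eq_coe, AlgEquiv.coe_ringEquiv, map_add, map_mul, map_sub, map_pow, eC, ex, ey, eu, ew, AlgEquiv.apply_symm_apply] at H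
  rwa [← hv, ← h0, ← h1, ← hs] at H
end polys
theorem sc0 {k : Type*} [Field k] {ρ ρ2 ρ' m n n' σ2 σ σ' α β γ : k}
  (h1 : ρ2*m=ρ*n) (h2 : σ2*n=σ*m) (h3 : ρ*σ=ρ2*σ2) (i1 : ρ*β+ρ2*γ = m*α+n*β)
  (i2 : m*β+n*γ = σ2*α+σ*β) : ρ*(σ2*α+σ*β)+ρ2*(σ2*β+σ*γ) - m*(m*α+n*β) - n*(m*β+n*γ) = 0 := by
  by_contra h
  grind
theorem sc1 {k : Type*} [Field k] {ρ ρ2 ρ' n' σ2 σ σ' a b η : k}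
  (H1 : ∀ t c, (ρ2+t^2*σ-2*c*t-t*(ρ+t^2*σ2-2*c))*(n'+t*σ'-c*t*σ2)-(ρ'+2*t*n'+t^2*σ'-c^2-c*(ρ+t^2*σ2-2*c))*(t*σ-c-t^2*σ2) = 0)
  (H2 : ∀ t c, (σ2+t^2*ρ-2*c*t-t*(σ+t^2*ρ2-2*c))*(n'+t*ρ'-c*t*ρ2)-(σ'+2*t*n'+t^2*ρ'-c^2-c*(σ+t^2*ρ2-2*c))*(t*ρ-c-t^2*ρ2) = 0)
  (i1 : ρ*(n'*η)+ρ2*(σ2*a+σ*b+σ'*η)-ρ'*b = -n'*a)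
  (i2 : -n'*b = σ2*(ρ*a+ρ2*b+ρ'*η)+σ*(n'*η)-σ'*a)
  (hD : ρ*(σ2*(ρ*a+ρ2*b+ρ'*η)+σ*(n'*η)-σ'*a)+ρ2*(σ2*(n'*η)+σ*(σ2*a+σ*b+σ'*η)-σ'*b)+ρ'*(-σ2*a-σ*b-σ'*η)+n'^2*η ≠ 0) : False := by
  have r1 : ρ' = ρ - 1 := by have := H1 0 0; have := H1 0 1; grind
  have s1 : σ' = σ - 1 := by have := H2 0 0; have := H2 0 1; grind
  subst r1 s1
  have r2 : ρ2*n'=0 := by have := H1 0 0; grind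
  have s2 : σ2*n'=0 := by have := H2 0 0; grind
  have all : ∀ c, c*((c-1)*(c+1-ρ)) = 0 := by intro c; have := H1 0 c; grind
  have all2 : ∀ c, c*((c-1)*(c+1-σ)) = 0 := by intro c; have := H2 0 c; grind
  by_cases h2 : (2:k) = 0
  · have F2 : ∀ c : k, c = 0 ∨ c = 1 := by
      intro c
      by_contra hc
      have := all c; have := all (c+1)
      grind
    have e1 := H1 1 0
    have e2 := H1 1 1
    have e3 := H2 1 0
    have e4 := H2 1 1
    clear H1 H2 all all2
    rcases F2 ρ with rfl | rfl <;> rcases F2 ρ2 with rfl | rfl <;> rcases F2 σ with rfl | rfl <;> rcases F2 σ2 with rfl | rfl <;> rcases F2 n' with rfl | rfl <;> grind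
  · have : ρ = 0 := by have := all (-1); grind
    have : σ = 0 := by have := all2 (-1); grind
    subst ρ σ
    have e1 := H1 1 0
    have e2 := H1 1 1
    have e3 := H1 1 (-1)
    have e4 := H1 (-1) 0
    have e5 := H1 (-1) 1
    have e6 := H1 (-1) (-1)
    grind

structure AD (k V : Type*) [Field k] [AddCommGroup V] [Module k V] where
  x : V
  ω : V
  m : V →ₗ[k] V →ₗ[k] V
  φ : V →ₗ[k] k
  δ : V →ₗ[k] V →ₗ[k] k
  κ : k
  hκ : κ ≠ 0
  comm : ∀ a b, m a b = m b a
  one : ∀ a, m x a = a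
  assoc : ∀ a b c, φ (m (m a b) c) = φ (m a (m b c))
  nd : ∀ a, (∀ b, φ (m a b) = 0) → a = 0
  alt : ∀ a, δ a a = 0
  δx : ∀ a, δ x a = 0
  δω : ∀ a, δ ω a = 0
  hA : ∀ a b c d, φ (m (m (m a b) c - m a (m b c)) d) = κ * δ a c * δ b d
  dec : ∀ y z, δ y z = 1 → ∀ v, ∃ s t : k, v = s • x + δ v z • y - δ v y • z + t • ω
  ind : ∀ s t : k, s • x + t • ω = 0 → s = 0 ∧ t = 0
  ex : ∃ y z, δ y z = 1

namespace AD
variable {k V : Type*} [Field k] [AddCommGroup V] [Module k V] (D : AD k V)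

theorem skew (a b : V) : D.δ a b = - D.δ b a := by
  have := D.alt (a+b)
  simp [D.alt] at this
  linear_combination this

theorem δx' (a : V) : D.δ a D.x = 0 := by rw [D.skew, D.δx, neg_zero]
theorem δω' (a : V) : D.δ a D.ω = 0 := by rw [D.skew, D.δω, neg_zero]

theorem one' (a : V) : D.m a D.x = a := by rw [D.comm, D.one]

theorem asc_of {a b c : V} (h : ∀ d, D.δ a c * D.δ b d = 0) :
    D.m (D.m a b) c = D.m a (D.m b c) := by
  rw [← sub_eq_zero]
  apply D.nd
  intro d
  rw [D.hA, mul_assoc, h, mul_zero]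

theorem of_asc {a b c : V} (h : D.m (D.m a b) c = D.m a (D.m b c)) (d : V) :
    D.δ a c * D.δ b d = 0 := by
  have := D.hA a b c d
  rw [h, sub_self, map_zero] at this
  simpa [D.hκ, mul_assoc] using this.symm

-- elements `n` of the radical are nuclear
theorem nuc1 {n : V} (hn : ∀ a, D.δ n a = 0) (b c : V) :
    D.m (D.m n b) c = D.m n (D.m b c) := D.asc_of (by simp [hn])
theorem nuc2 {n : V} (hn : ∀ a, D.δ n a = 0) (b c : V) :
    D.m (D.m b n) c = D.m b (D.m n c) := D.asc_of (by simp [hn])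

structure Fr (D : AD k V) (w : V) (τ : k) : Prop where
  hδ : ∀ a, D.δ w a = 0
  ww : D.m w w = τ • w
  indw : ∀ s t : k, s • D.x + t • w = 0 → s = 0 ∧ t = 0
  rad : ∀ y z, D.δ y z ≠ 0 → ∀ v, D.δ v y = 0 → D.δ v z = 0 → ∃ s t : k, v = s • D.x + t • w
  ex : ∃ y z, D.m w y = 0 ∧ D.m w z = 0 ∧ D.δ y z ≠ 0
  φw : D.φ w ≠ 0

theorem ωω : ∀ b, D.δ (D.m D.ω D.ω) b = 0 := by
  intro c
  obtain ⟨y, z, hyz⟩ := D.ex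
  have : D.m (D.m (D.m D.ω D.ω) y) c = D.m (D.m D.ω D.ω) (D.m y c) := by
    rw [D.nuc1 D.δω, D.nuc1 D.δω, D.nuc1 D.δω, D.nuc1 D.δω]
  simpa [hyz] using D.of_asc this z

theorem eωe (e : V) : D.δ e (D.m D.ω e) = 0 := by
  obtain ⟨y, z, hyz⟩ := D.ex
  have : D.m (D.m e y) (D.m D.ω e) = D.m e (D.m y (D.m D.ω e)) := by
    rw [← D.nuc2 D.δω, D.comm _ D.ω, D.nuc1 D.δω, D.asc_of (by simp [D.alt]), ← D.nuc2 D.δω,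
      D.comm y D.ω, D.nuc1 D.δω, ← D.nuc1 D.δω, ← D.nuc2 D.δω, D.comm e]
  simpa [hyz] using D.of_asc this z

theorem exists_fr : ∃ w τ, Fr D w τ := by
  obtain ⟨y, z, hyz⟩ := D.ex
  obtain ⟨μ, hμ⟩ : ∃ μ, μ = D.δ (D.m D.ω y) z := ⟨_, rfl⟩
  obtain ⟨N, hN⟩ : ∃ N, N = D.ω - μ • D.x := ⟨_, rfl⟩
  have hNδ : ∀ a, D.δ N a = 0 := by intro a; simp [hN, D.δx, D.δω]
  have hω : D.ω = N + μ • D.x := by rw [hN]; module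
  have dec : ∀ y z, D.δ y z = 1 → ∀ v, D.δ v y = 0 → D.δ v z = 0 → ∃ s t : k, v = s • D.x + t • N := by
    intro y z h v h1 h2
    obtain ⟨s, t, hst⟩ := D.dec y z h v
    rw [h1, h2, hω] at hst
    exact ⟨s + t * μ, t, by linear_combination (norm := module) hst⟩
  have ind : ∀ s t : k, s • D.x + t • N = 0 → s = 0 ∧ t = 0 := by
    intro s t h
    obtain ⟨h1, h2⟩ := D.ind (s - t*μ) t (by rw [hω]; linear_combination (norm := module) h)
    exact ⟨by linear_combination h1 + μ * h2, h2⟩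
  have hy := D.eωe y
  have hz := D.eωe z
  have hyz' := D.eωe (y+z)
  simp only [map_add, LinearMap.add_apply, hy, hz] at hyz'
  have sk1 := D.skew z (D.m D.ω y)
  have sk2 := D.skew y (D.m D.ω z)
  have sk3 := D.skew y (D.m D.ω y)
  have sk4 := D.skew z (D.m D.ω z)
  have sk5 := D.skew z y
  obtain ⟨fy, gy, hNy⟩ := dec y z hyz (D.m N y) 
    (by simp [hN, D.one, D.alt]; linear_combination sk3 - hy) 
    (by simp [hN, D.one, D.alt, hyz, hμ])
  obtain ⟨fz, gz, hNz⟩ := dec y z hyz (D.m N z) 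
    (by simp [hN, D.one, D.alt]; linear_combination sk2 - hyz' + sk1 + hμ - μ * sk5 + μ * hyz) 
    (by simp [hN, D.one, D.alt]; linear_combination sk4 - hz)
  have hNN' : ∀ b, D.δ (D.m N N) b = 0 := by
    intro b
    simp [hN, D.one, D.one', D.δω, D.δx, D.ωω]
  obtain ⟨α, τ, hNN⟩ := dec y z hyz (D.m N N) (hNN' _) (hNN' _)
  have ey := D.nuc1 hNδ N y
  have ez := D.nuc1 hNδ N z
  rw [hNy, hNN] at ey
  rw [hNz, hNN] at ez
  simp only [map_add, map_smul, LinearMap.add_apply, LinearMap.smul_apply, D.one, D.one', hNy, hNz, hNN] at ey ez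
  have hα : α = 0 := by
    have := congrArg (fun t => D.δ t z) ey
    simp [D.δx, hNδ, hyz] at this
    exact this
  subst hα
  have hfy : fy = 0 := (ind (- τ*fy) (fy) (by linear_combination (norm := module) -ey)).2
  have hfz : fz = 0 := (ind (- τ*fz) (fz) (by linear_combination (norm := module) -ez)).2
  subst hfy hfz
  have hNy0 : D.m N (y - gy • D.x) = 0 := by
    simp only [map_sub, map_smul, D.one', hNy]; module
  have hNz0 : D.m N (z - gz • D.x) = 0 := by
    simp only [map_sub, map_smul, D.one', hNz]; module
  refine ⟨N, τ, hNδ, by rw [hNN]; module, ind, ?_, ⟨y - gy • D.x, z - gz • D.x, hNy0, hNz0, ?_⟩, ?_⟩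
  · intro y z h v h1 h2
    exact dec ((D.δ y z)⁻¹ • y) z (by simp [h]) v (by simp [h1]) h2
  · simp [D.δx, D.δx', hyz]
  · intro h0
    have : N = 0 := by
      apply D.nd
      intro b
      obtain ⟨s, t, hb⟩ := D.dec y z hyz b
      rw [hb, hω]
      simp only [map_add, map_sub, map_smul, D.one', hNy, hNz, hNN, h0, smul_eq_mul, mul_zero, zero_smul, add_zero, sub_zero, map_zero, zero_add]
    have := (ind 0 1 (by rw [this]; simp)).2
    exact one_ne_zero this

variable {D}
namespace Fr
variable {w y z : V} {τ : k}

theorem dec4 (F : Fr D w τ) (h : D.δ y z ≠ 0) (v : V) : ∃ a b c d : k,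
    v = a • D.x + b • y + c • z + d • w := by
  have sk := D.skew z y
  obtain ⟨s, t, hst⟩ := F.rad y z h (v - (D.δ v z / D.δ y z) • y + (D.δ v y / D.δ y z) • z) 
    (by simp [D.alt, sk]; field_simp; ring) (by simp [D.alt]; field_simp; ring)
  exact ⟨s, D.δ v z / D.δ y z, - (D.δ v y / D.δ y z), t, by linear_combination (norm := module) hst⟩

theorem Hdec (F : Fr D w τ) (h : D.δ y z ≠ 0) (hy : D.m w y = 0) (hz : D.m w z = 0) (v : V)
    (hv : D.m w v = 0) : ∃ b c d : k, v = b • y + c • z + d • (w - τ • D.x) := by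
  obtain ⟨a, b, c, d, rfl⟩ := F.dec4 h v
  simp only [map_add, map_smul, hy, hz, F.ww, D.one'] at hv
  have := (F.indw 0 (a+d*τ) (by linear_combination (norm := module) hv)).2
  have : a = - d*τ := by linear_combination this
  subst this
  exact ⟨b, c, d, by module⟩

theorem mem_mul (F : Fr D w τ) {a : V} (ha : D.m w a = 0) (b : V) : D.m w (D.m a b) = 0 := by
  rw [← D.nuc1 F.hδ, ha]; simp

theorem hm (F : Fr D w τ) {a : V} (ha : D.m w a = 0) : D.m (w - τ • D.x) a = - τ • a := by
  simp [ha, D.one]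

theorem hm' (F : Fr D w τ) {a : V} (ha : D.m w a = 0) : D.m a (w - τ • D.x) = - τ • a := by
  rw [D.comm, F.hm ha]

theorem wh (F : Fr D w τ) : D.m w (w - τ • D.x) = 0 := by
  simp [F.ww, D.one']

theorem link (F : Fr D w τ) (hyz : D.δ y z ≠ 0) (hy : D.m w y = 0) (hz : D.m w z = 0)
    {r r2 r' m n n' : k} (e1 : D.m y y = r • y + r2 • z + r' • (w - τ • D.x))
    (e2 : D.m y z = m • y + n • z + n' • (w - τ • D.x)) (h : r2 * n' - r' * n ≠ 0) (v : V) 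
    (hv : D.m w v = 0) : ∃ a, D.m y a = v := by
  obtain ⟨t1, t2, t3, rfl⟩ := F.Hdec hyz hy hz v hv
  obtain ⟨i, hi⟩ : ∃ i, i * (r2 * n' - r' * n) = 1 := ⟨_, inv_mul_cancel₀ h⟩
  refine ⟨(t1 - ((t2*n'-t3*n)*i)*r - ((r2*t3-r'*t2)*i)*m) • D.x + ((t2*n'-t3*n)*i) • y + ((r2*t3-r'*t2)*i) • z, ?_⟩
  simp only [map_add, map_smul, D.one', e1, e2]
  have : ((t2*n'-t3*n)*i) • (r • y + r2 • z + r' • (w - τ • D.x)) +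
     ((r2*t3-r'*t2)*i) • (m • y + n • z + n' • (w - τ • D.x)) = 
     (((t2*n'-t3*n)*i)*r + ((r2*t3-r'*t2)*i)*m) • y + (t2 * (i * (r2 * n' - r' * n))) • z
      + (t3 * (i * (r2 * n' - r' * n))) • (w - τ • D.x) := by module
  rw [hi] at this
  linear_combination (norm := module) this

theorem delta (F : Fr D w τ) (hyz : D.δ y z ≠ 0) (hy : D.m w y = 0) (hz : D.m w z = 0)
    {r r2 r' m n n' s2 s s' : k} (e1 : D.m y y = r • y + r2 • z + r' • (w - τ • D.x))
    (e2 : D.m y z = m • y + n • z + n' • (w - τ • D.x)) 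
    (e3 : D.m z z = s2 • y + s • z + s' • (w - τ • D.x)) 
    (hneg : ∀ y z, D.m w y = 0 → D.m w z = 0 → D.δ y z ≠ 0 → 
       ¬ (∀ v, D.m w v = 0 → ∃ a, D.m y a = v)) (t c : k) :
    (r2+2*t*n+t^2*s-2*c*τ*t-t*(r+2*t*m+t^2*s2-2*c*τ)) * (n'+t*s'-c*(m+t*s2)) -
     (r'+2*t*n'+t^2*s'-c^2*τ-c*(r+2*t*m+t^2*s2-2*c*τ)) * (n+t*s-c*τ-t*(m+t*s2)) = 0 := by
  by_contra hne
  have hY : D.m w (y + t • z + c • (w - τ • D.x)) = 0 := by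
    simp only [map_add, map_smul, hy, hz, F.wh]; simp
  refine hneg (y + t • z + c • (w - τ • D.x)) z hY hz ?_ (F.link (r := (r+2*t*m+t^2*s2-2*c*τ)) (m := m+t*s2) ?_ hY hz ?_ ?_ hne)
  · simpa [D.alt, F.hδ, D.δx] using hyz
  · simpa [D.alt, F.hδ, D.δx] using hyz
  rotate_left 1
  · simp only [map_add, map_smul, LinearMap.add_apply, LinearMap.smul_apply, e2, e3, F.hm hz]
    module
  · have e2' := e2
    rw [D.comm] at e2'
    have hh := F.hm F.wh
    have h1 := F.hm hy
    have h2 := F.hm hz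
    have h3 := F.hm' hy
    have h4 := F.hm' hz
    generalize hh' : w - τ • D.x = h at *
    simp only [map_add, map_smul, LinearMap.add_apply, LinearMap.smul_apply, e1, e2, e2', e3, hh, h1, h2, h3, h4]
    module

theorem scale (F : Fr D w τ) (h : τ ≠ 0) : Fr D (τ⁻¹ • w) 1 := by
  obtain ⟨h1, h2, h3, h4, ⟨y, z, hy, hz, hyz⟩, h6⟩ := F
  refine ⟨by simp [h1], by simp [h2, h], ?_, ?_, ⟨y, z, by simp [hy], by simp [hz], hyz⟩, by simp [h6, h]⟩
  · intro s t hst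
    obtain ⟨g1, g2⟩ := h3 s (t*τ⁻¹) (by rw [← hst]; module)
    exact ⟨g1, by simpa [h] using g2⟩
  · intro y z hyz v e1 e2
    obtain ⟨s, t, rfl⟩ := h4 y z hyz v e1 e2
    exact ⟨s, t*τ, by rw [smul_smul, mul_assoc, mul_inv_cancel₀ h, mul_one]⟩

theorem Dne (hyz : D.δ y z ≠ 0) : D.φ (D.m (D.m y y) (D.m z z)) - D.φ (D.m (D.m y z) (D.m y z)) ≠ 0 := by
  have := D.hA y y z z
  rw [map_sub, LinearMap.sub_apply, map_sub, D.assoc, D.comm y (D.m y z), D.assoc (D.m y z) y z] at this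
  rw [this]
  exact mul_ne_zero (mul_ne_zero D.hκ hyz) hyz

theorem case0 (F : Fr D w 0) : ∃ y z, D.m w y = 0 ∧ D.m w z = 0 ∧ D.δ y z ≠ 0 ∧ 
       (∀ v, D.m w v = 0 → ∃ a, D.m y a = v) := by
  by_contra hneg
  replace hneg : ∀ y z, D.m w y = 0 → D.m w z = 0 → D.δ y z ≠ 0 → 
       ¬ (∀ v, D.m w v = 0 → ∃ a, D.m y a = v) := by
    intro y z h1 h2 h3 h4
    exact hneg ⟨y, z, h1, h2, h3, h4⟩
  obtain ⟨y, z, hy, hz, hyz⟩ := F.ex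
  obtain ⟨r, r2, r', e1⟩ := F.Hdec hyz hy hz (D.m y y) (F.mem_mul hy _)
  obtain ⟨m, n, n', e2⟩ := F.Hdec hyz hy hz (D.m y z) (F.mem_mul hy _)
  obtain ⟨s2, s, s', e3⟩ := F.Hdec hyz hy hz (D.m z z) (F.mem_mul hz _)
  have hzy : D.δ z y ≠ 0 := by rw [D.skew]; simpa using hyz
  have E1 := F.delta hyz hy hz e1 e2 e3 hneg
  have E2 := F.delta hzy hz hy (m := n) (n := m) (n' := n') (s2 := r2) (s := r) (s' := r') (r := s) (r2 := s2) (r' := s') (by rw [e3]; module) 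
    (by rw [D.comm, e2]; module) (by rw [e1]; module) hneg
  have a1 : r2*m = r*n := by have := E1 0 0; have := E1 0 1; grind
  have a2 : s2*n = s*m := by have := E2 0 0; have := E2 0 1; grind
  have a3 : r*s = r2*s2 := by have := E1 1 0; have := E1 1 1; grind
  apply Dne hyz
  have i1 := D.assoc y y z
  have i2 := D.assoc y z z
  have c := D.comm z y
  have hh := F.hm F.wh
  have h1 := F.hm hy
  have h2 := F.hm hz
  have h3 := F.hm' hy
  have h4 := F.hm' hz
  generalize hh' : w - (0:k) • D.x = h at *
  rw [e1, e2] at i1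
  rw [e2, e3] at i2
  have q := sc0 (ρ' := r') (n' := n') (σ' := s') (α := D.φ (D.m y y)) (β := D.φ (D.m y z)) (γ := D.φ (D.m z z)) a1 a2 a3
    (by simpa [h1,h2,h3,h4] using i1) (by simpa [h1,h2,h3,h4, c] using i2)
  rw [e1, e2, e3]
  have f1 : ∀ a b : k, D.φ (D.m y (a • y + b • z + s' • h)) = a * D.φ (D.m y y) + b * D.φ (D.m y z) := by
    intro a b; simp [h3]
  simp only [map_add, map_smul, LinearMap.add_apply, LinearMap.smul_apply, hh, h1, h2, h3, h4, c, smul_eq_mul, neg_zero, zero_smul, smul_zero, map_zero, mul_zero]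
  linear_combination q

theorem case1 (F : Fr D w 1) : ∃ y z, D.m w y = 0 ∧ D.m w z = 0 ∧ D.δ y z ≠ 0 ∧ 
       (∀ v, D.m w v = 0 → ∃ a, D.m y a = v) := by
  by_contra hneg
  replace hneg : ∀ y z, D.m w y = 0 → D.m w z = 0 → D.δ y z ≠ 0 → 
       ¬ (∀ v, D.m w v = 0 → ∃ a, D.m y a = v) := by
    intro y z h1 h2 h3 h4
    exact hneg ⟨y, z, h1, h2, h3, h4⟩
  obtain ⟨y, z, hy, hz, hyz, n', e2⟩ : ∃ y z, D.m w y = 0 ∧ D.m w z = 0 ∧ D.δ y z ≠ 0 ∧ 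
      ∃ n' : k, D.m y z = n' • (w - (1:k) • D.x) := by
    obtain ⟨y, z, hy, hz, hyz⟩ := F.ex
    obtain ⟨m, n, n', e2⟩ := F.Hdec hyz hy hz (D.m y z) (F.mem_mul hy _)
    refine ⟨y + n • (w - (1:k) • D.x), z + m • (w - (1:k) • D.x), ?_, ?_, ?_, n' - n*m, ?_⟩
    · simp only [map_add, map_smul, hy, F.wh]; simp
    · simp only [map_add, map_smul, hz, F.wh]; simp
    · have : D.δ y w = 0 := by rw [D.skew, F.hδ, neg_zero]
      simpa [F.hδ, D.δx, D.δx', this] using hyz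
    · have hh := F.hm F.wh
      have h1 := F.hm hz
      have h2 := F.hm' hy
      simp only [map_add, map_smul, LinearMap.add_apply, LinearMap.smul_apply, e2, hh, h1, h2]
      module
  obtain ⟨r, r2, r', e1⟩ := F.Hdec hyz hy hz (D.m y y) (F.mem_mul hy _)
  obtain ⟨s2, s, s', e3⟩ := F.Hdec hyz hy hz (D.m z z) (F.mem_mul hz _)
  have hzy : D.δ z y ≠ 0 := by rw [D.skew]; simpa using hyz
  have E1 := F.delta hyz hy hz (m := 0) (n := 0) (n' := n') e1 (by rw [e2]; module) e3 hneg
  have E2 := F.delta hzy hz hy (m := 0) (n := 0) (n' := n') (s2 := r2) (s := r) (s' := r') (r := s) (r2 := s2) (r' := s') (by rw [e3]; module) 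
    (by rw [D.comm, e2]; module) (by rw [e1]; module) hneg
  have i0 := Dne hyz
  have i1 := D.assoc y y z
  have i2 := D.assoc y z z
  have c := D.comm z y
  have hh := F.hm F.wh
  have h1 := F.hm hy
  have h2 := F.hm hz
  have h3 := F.hm' hy
  have h4 := F.hm' hz
  generalize hh' : w - (1:k) • D.x = h at *
  rw [e1, e2] at i1
  rw [e2, e3] at i2
  rw [e1, e2, e3] at i0
  simp only [map_add, map_smul, LinearMap.add_apply, LinearMap.smul_apply, hh, h1, h2, h3, h4, c, smul_eq_mul, e1, e2, e3] at i0 i1 i2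
  refine sc1 (ρ := r) (ρ2 := r2) (ρ' := r') (n' := n') (σ2 := s2) (σ := s) (σ' := s') (a := D.φ y) (b := D.φ z) (η := D.φ h) ?_ ?_ ?_ ?_ ?_
  · intro t c; rw [← E1 t c]; ring
  · intro t c; rw [← E2 t c]; ring
  · linear_combination i1
  · linear_combination i2
  · intro hc; apply i0; linear_combination hc

end Fr

theorem exists_good (D : AD k V) : ∃ w τ y z, Fr D w τ ∧ D.m w y = 0 ∧ D.m w z = 0 ∧ D.δ y z ≠ 0 ∧ 
       (∀ v, D.m w v = 0 → ∃ a, D.m y a = v) := by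
  obtain ⟨w, τ, F⟩ := D.exists_fr
  by_cases h : τ = 0
  · subst h
    obtain ⟨y, z, hh⟩ := F.case0
    exact ⟨w, 0, y, z, F, hh⟩
  · obtain ⟨y, z, hh⟩ := (F.scale h).case1
    exact ⟨_, 1, y, z, F.scale h, hh⟩

namespace Fr
variable {w y z : V} {τ : k}

theorem hN {u a0 a1 : V} (hy : D.m w y = 0) (hyu : D.δ y u ≠ 0)
    (hu : D.m w u = 0)
    {σ α0 α1 α2 α3 β0 β1 β2 β3 : k} (e1 : u + D.m y a1 = 0) (e0 : D.m u u - σ • u + D.m y a0 = 0)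
    (h0 : a0 = α0 • D.x + α1 • y + α2 • u + α3 • w)
    (h1 : a1 = β0 • D.x + β1 • y + β2 • u + β3 • w) :
    ¬ (β1 = β2 * β0 ∧ α1 = α2 * β0 - β0^2 ∧ α0 = - β0 * σ) := by
  rintro ⟨rfl, rfl, rfl⟩
  subst h0 h1
  have hy' : D.m y w = 0 := by rw [D.comm, hy]
  have uy : D.m u y = D.m y u := D.comm _ _
  have uG : D.δ (u + β0 • y) y ≠ 0 := by
    rw [map_add, map_smul]
    simp [D.alt]
    rw [D.skew]; simpa using hyu
  simp only [map_add, map_smul, D.one', hy'] at e1 e0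
  have k1 : β2 • D.m y (u + β0 • y) = - (u + β0 • y) := by
    simp only [map_add, map_smul]
    linear_combination (norm := module) e1
  have k2 : D.m (u + β0 • y) u = σ • (u + β0 • y) - (α2 - β0) • D.m y (u + β0 • y) := by
    simp only [map_add, map_smul, LinearMap.add_apply, LinearMap.smul_apply, uy]
    linear_combination (norm := module) e0
  generalize u + β0 • y = G at *
  have b2 : β2 ≠ 0 := by
    rintro rfl
    apply uG
    have : G = 0 := by linear_combination (norm := module) k1
    simp [this]
  have k1' : D.m y G = (-β2⁻¹) • G := by
    have : D.m y G = β2⁻¹ • (β2 • D.m y G) := by rw [smul_smul, inv_mul_cancel₀ b2, one_smul]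
    rw [this, k1]; module
  rw [k1'] at k2
  have k3 : D.m (D.m y G) u = D.m y (D.m G u) := by
    rw [k2, k1']
    simp only [map_sub, map_smul, LinearMap.smul_apply, k1', k2]
    module
  have := D.of_asc k3 y
  simp [hyu, uG] at this

theorem ext0 (F : Fr D w τ) (h : D.δ y z ≠ 0) {v : V} (h0 : D.φ (D.m v D.x) = 0)
    (h1 : D.φ (D.m v y) = 0) (h2 : D.φ (D.m v z) = 0) (h3 : D.φ (D.m v w) = 0) : v = 0 := by
  apply D.nd
  intro b
  obtain ⟨a, b, c, d, rfl⟩ := F.dec4 h b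
  simp [h0, h1, h2, h3]

theorem kerφ (F : Fr D w τ) (hyz : D.δ y z ≠ 0) (hy : D.m w y = 0) 
    {a0 a2 c : V} {l : k} (e2 : D.m y a2 = - (z + (w - τ • D.x)))
    (e0 : D.m y a0 = - (D.m z (z + (w - τ • D.x)))) (hc : c = l • w - a0 + D.m z a2)
    (hφ : D.φ c = 0) (M : Submodule k V)
    (hM : ∀ a b c, D.m (D.m a b) c - D.m a (D.m b c) ∈ M) (hcM : c ∈ M) (v : V) (hv : D.φ v = 0) :
    v ∈ M := by
  have hy' : D.m y w = 0 := by rw [D.comm, hy]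
  have yc : D.m y c = - (D.m (D.m y a2) z - D.m y (D.m a2 z)) := by
    rw [hc, e2, D.comm a2 z]
    simp only [map_add, map_sub, map_neg, map_smul, e0, hy', LinearMap.neg_apply, LinearMap.add_apply,
      LinearMap.sub_apply, LinearMap.smul_apply, D.one, D.one', D.comm w z]
    module
  have cx : D.φ (D.m c D.x) = 0 := by rwa [D.one']
  have cy : D.φ (D.m c y) = 0 := by
    have := D.hA y a2 z D.x
    rw [D.one', D.δx', mul_zero] at this
    rw [D.comm, yc, map_neg, this, neg_zero]
  have cv : D.φ (D.m c (z + (w - τ • D.x))) = 0 := by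
    have e : z + (w - τ • D.x) = - D.m y a2 := by rw [e2, neg_neg]
    rw [e, map_neg, map_neg, ← D.assoc, D.comm c y, yc, map_neg, LinearMap.neg_apply, map_neg, D.hA, D.alt]
    simp
  have cz : D.φ (D.m c z) = - D.φ (D.m c w) := by
    simp only [map_add, map_sub, map_smul, cx] at cv
    simp at cv
    linear_combination cv
  have c0 : c ≠ 0 := by
    intro c0
    rw [c0, map_zero, eq_comm, neg_eq_zero, sub_eq_zero] at yc
    have := D.of_asc yc
    have h2 : ∀ d, D.δ a2 d = 0 := by simpa [hyz] using this
    obtain ⟨s, t, rfl⟩ := F.rad y z hyz a2 (h2 _) (h2 _)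
    have := congrArg (fun a => D.δ a y) e2
    simp [D.one', hy', D.alt, F.hδ, D.δx] at this
    apply hyz
    rw [D.skew, this, neg_zero]
  have cw : D.φ (D.m c w) ≠ 0 := fun h => c0 (F.ext0 hyz cx cy (by rw [cz, h, neg_zero]) h)
  have k1 := D.hA y y z
  have k2 := D.hA y z z
  have m1 := hM y y z
  have m2 := hM y z z
  generalize D.m (D.m y y) z - D.m y (D.m y z) = p at *
  generalize D.m (D.m y z) z - D.m y (D.m z z) = q at *
  have hκ := D.hκ
  have sk := D.skew z y
  set d := D.δ y z with hd
  set r := D.φ (D.m v w) / D.φ (D.m c w) with hr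
  have hr' : r * D.φ (D.m c w) = D.φ (D.m v w) := by rw [hr]; field_simp
  have key : v - r • c - ((D.φ (D.m v z) + D.φ (D.m v w)) / (D.κ * d * d)) • p
      + (D.φ (D.m v y) / (D.κ * d * d)) • q = 0 := by
    apply F.ext0 (y := y) (z := z) hyz
    · have k1x := k1 D.x
      have k2x := k2 D.x
      rw [D.δx', D.one', mul_zero] at k1x k2x
      simp [k1x, k2x, hv, D.one', hφ]
    · simp [k1, k2, cy, D.alt, sk]; field_simp; ring
    · simp [k1, k2, cz, D.alt, hr', ← hd]; field_simp; ring
    · simp [k1, k2, hr', D.skew _ w, F.hδ]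
  have : v = r • c + ((D.φ (D.m v z) + D.φ (D.m v w)) / (D.κ * d * d)) • p
      - (D.φ (D.m v y) / (D.κ * d * d)) • q := by linear_combination (norm := module) key
  rw [this]
  exact M.sub_mem (M.add_mem (M.smul_mem _ hcM) (M.smul_mem _ m1)) (M.smul_mem _ m2)

theorem spanning (F : Fr D w τ) (hyz : D.δ y z ≠ 0) (hy : D.m w y = 0) (hz : D.m w z = 0)
    (hs : ∀ v, D.m w v = 0 → ∃ a, D.m y a = v)
    {a1 a2 : V} (e1 : D.m y a1 = - z) (e2 : D.m y a2 = - (z + (w - τ • D.x))) (v : V) :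
    ∃ a b c d : k, v = a • D.x + b • a1 + c • a2 + d • w := by
  have hy' : D.m y w = 0 := by rw [D.comm, hy]
  obtain ⟨b, c, d, h⟩ := F.Hdec hyz hy hz (D.m y v) (F.mem_mul hy v)
  have hn : D.m y (v - b • D.x + d • a2 + (c - d) • a1) = 0 := by
    simp only [map_add, map_sub, map_smul, h, D.one', e1, e2]
    module
  obtain ⟨n, hn'⟩ : ∃ n, n = v - b • D.x + d • a2 + (c - d) • a1 := ⟨_, rfl⟩
  rw [← hn'] at hn
  have orth : ∀ a, D.m w a = 0 → D.φ (D.m n a) = 0 := by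
    intro a ha
    obtain ⟨a, rfl⟩ := hs a ha
    rw [← D.assoc, D.comm n, hn]; simp
  have key : n - (D.φ n / D.φ w) • w = 0 := by
    have hw := F.φw
    have hx : D.φ ((D.m (n - (D.φ n / D.φ w) • w)) D.x) = 0 := by
      simp [D.one']; field_simp; ring
    apply F.ext0 hyz hx
    · simp [orth y hy, hy]
    · simp [orth z hz, hz]
    · have := orth _ F.wh
      simp [D.one'] at this
      simp [F.ww]; field_simp; linear_combination this
  exact ⟨b, -(c-d), -d, D.φ n / D.φ w, by linear_combination (norm := module) key - hn'⟩
end Fr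
end AD

section glue
variable {k : Type*} [Field k]
local notation "P" => MvPolynomial (Fin 4) k
abbrev VV (k : Type*) [Field k] := ↥(homogeneousSubmodule (Fin 4) k 1)
local notation "V" => VV k

theorem rank_one_sym (A : Matrix (Fin 3) (Fin 3) k) (hs : ∀ i j, A i j = A j i) (hr : A.rank = 1) :
    ∃ (κ : k) (n : Fin 3 → k), κ ≠ 0 ∧ n ≠ 0 ∧ ∀ i j, A i j = κ * n i * n j := by
  unfold Matrix.rank at hr
  obtain ⟨v, hv, h⟩ := finrank_eq_one_iff'.1 hr
  have h2 : ∀ j, ∃ c : k, ∀ i, A i j = c * v.1 i := by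
    intro j
    obtain ⟨c, hc⟩ := h ⟨A.mulVecLin (Pi.single j 1), LinearMap.mem_range_self _ _⟩
    refine ⟨c, fun i => ?_⟩
    have := congrFun (congrArg Subtype.val hc) i
    simp at this
    exact this.symm
  choose c hc using h2
  have hv' : v.1 ≠ 0 := fun h => hv (Subtype.ext h)
  obtain ⟨i0, hi0⟩ := Function.ne_iff.1 hv'
  have hi0' : v.1 i0 ≠ 0 := hi0
  have hc' : ∀ j, c j = c i0 / v.1 i0 * v.1 j := by
    intro j
    have := hs i0 j
    rw [hc, hc] at this
    field_simp
    linear_combination this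
  refine ⟨c i0 / v.1 i0, v.1, ?_, hv', ?_⟩
  · intro h0
    have hc0 : ∀ j, c j = 0 := by intro j; rw [hc', h0, zero_mul]
    have hA : A = 0 := by ext i j; rw [hc, hc0]; simp
    have := Matrix.rank_zero (m := Fin 3) (n := Fin 3) (R := k)
    rw [← hA, Matrix.rank, hr] at this
    omega
  · intro i j
    rw [hc, hc' j]; ring

def Vx (i : Fin 4) : V := ⟨X i, isHomogeneous_X _ _⟩

def cf (i : Fin 4) : V →ₗ[k] k := (lcoeff k (Finsupp.single i 1)).comp (Submodule.subtype _)

theorem cf_Vx (i j : Fin 4) : cf (k := k) i (Vx j) = if i = j then 1 else 0 := by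
  simp [cf, Vx, coeff_X, Finsupp.single_left_inj, eq_comm]

theorem V_eq (a : V) : a = cf 0 a • Vx 0 + cf 1 a • Vx 1 + cf 2 a • Vx 2 + cf 3 a • Vx 3 := by
  obtain ⟨a, ha⟩ := a
  have h2 : a ∈ Submodule.span k (Set.range (X : Fin 4 → P)) := by
    rwa [← homogeneousSubmodule_one_eq_span_X]
  suffices ∀ a (h : a ∈ Submodule.span k (Set.range (X : Fin 4 → P))) (ha : a ∈ homogeneousSubmodule (Fin 4) k 1),
      a = (cf 0 ⟨a, ha⟩ • Vx 0 + cf 1 ⟨a, ha⟩ • Vx 1 + cf 2 ⟨a, ha⟩ • Vx 2 + cf 3 ⟨a, ha⟩ • Vx 3 : V).1 from 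
    Subtype.ext (this a h2 ha)
  intro a h
  induction h using Submodule.span_induction with
  | mem x h =>
    obtain ⟨i, rfl⟩ := h
    intro hi
    have := fun j => cf_Vx (k := k) j i
    unfold Vx at this
    simp only [this]
    fin_cases i <;> simp [Vx]
  | zero => intro h; simp [cf]
  | add x y hx hy hx' hy' =>
    intro h
    rw [← homogeneousSubmodule_one_eq_span_X] at hx hy
    have e : (⟨x + y, h⟩ : V) = ⟨x, hx⟩ + ⟨y, hy⟩ := rfl
    simp only [e, map_add]
    conv_lhs => rw [hx' hx, hy' hy]
    simp only [Submodule.coe_add, Submodule.coe_smul]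
    module
  | smul c x hx hx' =>
    intro h
    rw [← homogeneousSubmodule_one_eq_span_X] at hx
    have e : (⟨c • x, h⟩ : V) = c • ⟨x, hx⟩ := rfl
    simp only [e, map_smul]
    conv_lhs => rw [hx' hx]
    simp only [Submodule.coe_add, Submodule.coe_smul]
    module

theorem cross (G : V →ₗ[k] V →ₗ[k] k) (alt : ∀ a, G a a = 0) (h0 : ∀ a, G (Vx 0) a = 0) (a b : V) :
    G a b = (cf 2 a * cf 3 b - cf 3 a * cf 2 b) * G (Vx 2) (Vx 3)
      + (cf 3 a * cf 1 b - cf 1 a * cf 3 b) * G (Vx 3) (Vx 1)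
      + (cf 1 a * cf 2 b - cf 2 a * cf 1 b) * G (Vx 1) (Vx 2) := by
  have sk : ∀ a b, G a b = - G b a := by
    intro a b
    have := alt (a+b)
    simp [alt] at this
    linear_combination this
  conv_lhs => rw [V_eq a, V_eq b]
  have h0' : ∀ a, G a (Vx 0) = 0 := fun a => by rw [sk, h0, neg_zero]
  simp only [map_add, map_smul, LinearMap.add_apply, LinearMap.smul_apply, h0, h0', alt, smul_eq_mul]
  rw [sk (Vx 2) (Vx 1), sk (Vx 3) (Vx 2), sk (Vx 1) (Vx 3)]
  ring

variable (Φ : MvPolynomial (Fin 4) k →ₗ[k] k) (hp : Function.Bijective (pMap k Φ))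

def trip (a b : V) : V →ₗ[k] k := (Φ.comp (LinearMap.mulLeft k (a.1 * b.1))).comp (Submodule.subtype _)

theorem trip_apply (a b v : V) : trip Φ a b v = Φ (a.1 * b.1 * v.1) := rfl

def mV : V →ₗ[k] V →ₗ[k] V := LinearMap.mk₂ k
  (fun a b => (LinearEquiv.ofBijective (pMap k Φ) hp).symm (trip Φ a b))
  (by intro a b c; rw [← map_add]; congr 1; ext v; simp [trip_apply, add_mul])
  (by intro a b c; rw [← map_smul]; congr 1; ext v; simp [trip_apply])
  (by intro a b c; rw [← map_add]; congr 1; ext v; simp [trip_apply, add_mul, mul_add])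
  (by intro a b c; rw [← map_smul]; congr 1; ext v; simp [trip_apply])

theorem mV_spec (a b v : V) : Φ (X 0 * (mV Φ hp a b).1 * v.1) = Φ (a.1 * b.1 * v.1) := by
  have : (LinearEquiv.ofBijective (pMap k Φ) hp) (mV Φ hp a b) = trip Φ a b := by
    simp only [mV, LinearMap.mk₂_apply, LinearEquiv.apply_symm_apply]
  exact congrArg (fun f => f v) this

theorem V_ext (hp : Function.Bijective (pMap k Φ)) {a b : V} (h : ∀ v : V, Φ (X 0 * a.1 * v.1) = Φ (X 0 * b.1 * v.1)) : a = b := by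
  apply hp.1
  ext v
  exact h v

def φV : V →ₗ[k] k := (Φ.comp (LinearMap.mulLeft k (X 0 ^ 2))).comp (Submodule.subtype _)

theorem φV_apply (a : V) : φV Φ a = Φ (X 0 ^ 2 * a.1) := rfl

theorem φmm (a b : V) : φV Φ (mV Φ hp a b) = Φ (X 0 * a.1 * b.1) := by
  rw [φV_apply]
  have := mV_spec Φ hp a b (Vx 0)
  simp only [Vx] at this
  rw [show X 0 * a.1 * b.1 = a.1 * b.1 * X 0 by ring, ← this]
  congr 1; ring

theorem mV_comm (a b : V) : mV Φ hp a b = mV Φ hp b a := by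
  apply V_ext Φ hp
  intro v
  rw [mV_spec, mV_spec, mul_comm a.1]

theorem mV_one (a : V) : mV Φ hp (Vx 0) a = a := by
  apply V_ext Φ hp
  intro v
  rw [mV_spec]; rfl

theorem mV_assoc (a b c : V) : φV Φ (mV Φ hp (mV Φ hp a b) c) = φV Φ (mV Φ hp a (mV Φ hp b c)) := by
  rw [φmm, mV_spec, φmm, show X 0 * a.1 * (mV Φ hp b c).1 = X 0 * (mV Φ hp b c).1 * a.1 by ring, mV_spec]
  congr 1; ring

def FV (c d : V) : V →ₗ[k] V →ₗ[k] k := LinearMap.mk₂ k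
  (fun a b => φV Φ (mV Φ hp (mV Φ hp a c) (mV Φ hp b d)) - φV Φ (mV Φ hp (mV Φ hp a d) (mV Φ hp b c)))
  (by intros; simp; ring) (by intros; simp; ring) (by intros; simp; ring) (by intros; simp; ring)

theorem FV_apply (a b c d : V) : FV Φ hp c d a b = 
  φV Φ (mV Φ hp (mV Φ hp a c) (mV Φ hp b d)) - φV Φ (mV Φ hp (mV Φ hp a d) (mV Φ hp b c)) := rfl

theorem FV_symm (a b c d : V) : FV Φ hp c d a b = FV Φ hp a b c d := by
  rw [FV_apply, FV_apply, mV_comm Φ hp a c, mV_comm Φ hp b d, mV_comm Φ hp c b, mV_comm Φ hp d a,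
    mV_comm Φ hp (mV Φ hp b c)]

theorem FV_alt (c d a : V) : FV Φ hp c d a a = 0 := by
  rw [FV_apply, mV_comm Φ hp (mV Φ hp a c), sub_self]

theorem FV_x (c d a : V) : FV Φ hp c d (Vx 0) a = 0 := by
  rw [FV_apply, mV_one, mV_one, ← mV_assoc, ← mV_assoc, mV_comm Φ hp d, mV_comm Φ hp c, mV_assoc, mV_assoc,
    mV_comm Φ hp c, sub_self]

theorem FV_hA (a b c d : V) : 
    φV Φ (mV Φ hp (mV Φ hp (mV Φ hp a b) c - mV Φ hp a (mV Φ hp b c)) d) = FV Φ hp b d a c := by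
  have h2 : ∀ q, φV Φ (mV Φ hp (mV Φ hp a q) d) = φV Φ (mV Φ hp (mV Φ hp a d) q) := by
    intro q
    rw [mV_comm Φ hp a q, mV_assoc, mV_comm]
  rw [FV_apply, map_sub, LinearMap.sub_apply, map_sub, h2, mV_assoc Φ hp (mV Φ hp a b), mV_comm Φ hp b c]

theorem φ_sm (a b : V) (q l : P) (hl : l ∈ homogeneousSubmodule (Fin 4) k 1) (hq : q = a.1 * b.1)
    (c d : V)
    (h : ∀ v ∈ homogeneousSubmodule (Fin 4) k 1, Φ (X 0 * l * v) = Φ (c.1 * d.1 * v)) : 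
    Φ (q * l) = φV Φ (mV Φ hp (mV Φ hp a b) (mV Φ hp c d)) := by
  have : (⟨l, hl⟩ : V) = mV Φ hp c d := by
    apply V_ext Φ hp
    intro v
    rw [mV_spec]; exact h _ v.2
  rw [← this, φmm, mV_spec, hq]
def xV (n : Fin 3 → k) (a b : V) : k := n 0 * (cf 2 a * cf 3 b - cf 3 a * cf 2 b) 
      + n 1 * (cf 3 a * cf 1 b - cf 1 a * cf 3 b)
      + n 2 * (cf 1 a * cf 2 b - cf 2 a * cf 1 b)

def dV (n : Fin 3 → k) : V →ₗ[k] V →ₗ[k] k := LinearMap.mk₂ k (xV n)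
  (by intros; simp [xV]; ring) (by intros; simp [xV]; ring)
  (by intros; simp [xV]; ring) (by intros; simp [xV]; ring)

theorem dV_apply (n : Fin 3 → k) (a b : V) : dV n a b = n 0 * (cf 2 a * cf 3 b - cf 3 a * cf 2 b) 
      + n 1 * (cf 3 a * cf 1 b - cf 1 a * cf 3 b)
      + n 2 * (cf 1 a * cf 2 b - cf 2 a * cf 1 b) := rfl

def bV : Fin 3 → V × V := ![(Vx 2, Vx 3), (Vx 3, Vx 1), (Vx 1, Vx 2)]

theorem FV_eq (κ : k) (n : Fin 3 → k) (h : ∀ i j, FV Φ hp (bV i).1 (bV i).2 (bV j).1 (bV j).2 = κ * n i * n j)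
    (a b c d : V) : FV Φ hp a b c d = κ * dV n a b * dV n c d := by
  have h1 : ∀ i, FV Φ hp (bV i).1 (bV i).2 c d = κ * n i * dV n c d := by
    intro i
    have h0 := h i 0
    have h1 := h i 1
    have h2 := h i 2
    simp only [bV, Matrix.cons_val] at h0 h1 h2 ⊢
    rw [cross _ (FV_alt Φ hp _ _) (FV_x Φ hp _ _), h0, h1, h2, dV_apply]
    ring
  rw [FV_symm, cross _ (FV_alt Φ hp _ _) (FV_x Φ hp _ _)]
  have h2 := h1 0
  have h3 := h1 1
  have h4 := h1 2
  simp only [bV, Matrix.cons_val] at h2 h3 h4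
  rw [FV_symm, h2, FV_symm, h3, FV_symm, h4, dV_apply n a b]
  ring

def mkAD (κ : k) (hκ : κ ≠ 0) (n : Fin 3 → k) (hn : n ≠ 0)
    (h : ∀ i j, FV Φ hp (bV i).1 (bV i).2 (bV j).1 (bV j).2 = κ * n i * n j) : AD k V where
  x := Vx 0
  ω := n 0 • Vx 1 + n 1 • Vx 2 + n 2 • Vx 3
  m := mV Φ hp
  φ := φV Φ
  δ := dV n
  κ := κ
  hκ := hκ
  comm := mV_comm Φ hp
  one := mV_one Φ hp
  assoc := mV_assoc Φ hp
  nd := by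
    intro a ha
    apply V_ext Φ hp
    intro v
    rw [← φmm Φ hp, ha]; simp
  alt := by intro a; rw [dV_apply]; ring
  δx := by intro a; simp [dV_apply, cf_Vx]
  δω := by intro a; simp [dV_apply, cf_Vx]; ring
  hA := by
    intro a b c d
    rw [FV_hA, FV_symm, FV_eq Φ hp κ n h]
  dec := by
    intro y z hyz v
    rw [dV_apply] at hyz
    have key : ∃ t : k, v - (dV n v z • y - dV n v y • z + t • (n 0 • Vx 1 + n 1 • Vx 2 + n 2 • Vx 3)) = 
      cf 0 (v - (dV n v z • y - dV n v y • z + t • (n 0 • Vx 1 + n 1 • Vx 2 + n 2 • Vx 3))) • Vx 0 := by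
      refine ⟨cf 1 v * (cf 2 y * cf 3 z - cf 3 y * cf 2 z) + cf 2 v * (cf 3 y * cf 1 z - cf 1 y * cf 3 z)
        + cf 3 v * (cf 1 y * cf 2 z - cf 2 y * cf 1 z), ?_⟩
      refine (V_eq _).trans ?_
      have e1 : ∀ r : V, cf 1 r = 0 → cf 2 r = 0 → cf 3 r = 0 → 
        cf 0 r • Vx 0 + cf 1 r • Vx 1 + cf 2 r • Vx 2 + cf 3 r • Vx 3 = (cf 0 r • Vx 0 : V) := by
        intro r h1 h2 h3
        simp [h1, h2, h3]
      apply e1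
      · simp [dV_apply, cf_Vx]
        linear_combination (- cf 1 v) * hyz
      · simp [dV_apply, cf_Vx]
        linear_combination (- cf 2 v) * hyz
      · simp [dV_apply, cf_Vx]
        linear_combination (- cf 3 v) * hyz
    obtain ⟨t, ht⟩ := key
    exact ⟨_, t, by linear_combination (norm := module) ht⟩
  ind := by
    intro s t h
    have h0 := congrArg (cf 0) h
    have h1 := congrArg (cf 1) h
    have h2 := congrArg (cf 2) h
    have h3 := congrArg (cf 3) h
    simp [cf_Vx] at h0 h1 h2 h3
    refine ⟨h0, ?_⟩
    by_contra ht
    apply hn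
    simp only [ht, false_or] at h1 h2 h3
    funext i
    fin_cases i <;> simp [h1, h2, h3]
  ex := by
    obtain ⟨i, hi⟩ := Function.ne_iff.1 hn
    replace hi : n i ≠ 0 := hi
    refine ⟨(n i)⁻¹ • (bV i).1, (bV i).2, ?_⟩
    fin_cases i <;> simp [dV_apply, bV, cf_Vx] at hi ⊢ <;> field_simp

theorem exists_AD (hp : Function.Bijective (pMap k Φ))
    (ly2 lyz lyw lz2 lzw lw2 : P)
    (hlyzm : lyz ∈ homogeneousSubmodule (Fin 4) k 1)
    (hlywm : lyw ∈ homogeneousSubmodule (Fin 4) k 1)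
    (hlz2m : lz2 ∈ homogeneousSubmodule (Fin 4) k 1)
    (hlzwm : lzw ∈ homogeneousSubmodule (Fin 4) k 1)
    (hlw2m : lw2 ∈ homogeneousSubmodule (Fin 4) k 1)
    (hlyz : ∀ v ∈ homogeneousSubmodule (Fin 4) k 1,
      Φ (X 0 * lyz * v) = Φ (X 1 * X 2 * v))
    (hlyw : ∀ v ∈ homogeneousSubmodule (Fin 4) k 1,
      Φ (X 0 * lyw * v) = Φ (X 1 * X 3 * v))
    (hlz2 : ∀ v ∈ homogeneousSubmodule (Fin 4) k 1,
      Φ (X 0 * lz2 * v) = Φ (X 2 ^ 2 * v))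
    (hlzw : ∀ v ∈ homogeneousSubmodule (Fin 4) k 1,
      Φ (X 0 * lzw * v) = Φ (X 2 * X 3 * v))
    (hlw2 : ∀ v ∈ homogeneousSubmodule (Fin 4) k 1,
      Φ (X 0 * lw2 * v) = Φ (X 3 ^ 2 * v))
    (hSM : (smMatrix k Φ ly2 lyz lyw lz2 lzw lw2).rank = 1) :
    ∃ D : AD k V, D.x.1 = X 0 ∧ (∀ a b v : V, Φ (X 0 * (D.m a b).1 * v.1) = Φ (a.1 * b.1 * v.1)) ∧
      ∀ a, D.φ a = Φ (X 0 ^ 2 * a.1) := by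
  have hM : ∀ i j, smMatrix k Φ ly2 lyz lyw lz2 lzw lw2 i j = FV Φ hp (bV i).1 (bV i).2 (bV j).1 (bV j).2 := by
    have fyz := fun a b q hq => φ_sm Φ hp a b q lyz hlyzm hq (Vx 1) (Vx 2) hlyz
    have fyw := fun a b q hq => φ_sm Φ hp a b q lyw hlywm hq (Vx 1) (Vx 3) hlyw
    have fzw := fun a b q hq => φ_sm Φ hp a b q lzw hlzwm hq (Vx 2) (Vx 3) hlzw
    have fz2 := fun a b q hq => φ_sm Φ hp a b q lz2 hlz2m hq (Vx 2) (Vx 2) 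
      (fun v hv => by rw [hlz2 v hv, pow_two]; rfl)
    have fw2 := fun a b q hq => φ_sm Φ hp a b q lw2 hlw2m hq (Vx 3) (Vx 3) 
      (fun v hv => by rw [hlw2 v hv, pow_two]; rfl)
    have q11 : (X 1 ^ 2 : P) = (Vx 1).1 * (Vx 1).1 := pow_two _
    have q22 : (X 2 ^ 2 : P) = (Vx 2).1 * (Vx 2).1 := pow_two _
    have q12 : (X 1 * X 2 : P) = (Vx 1).1 * (Vx 2).1 := rfl
    have q21 : (X 2 * X 1 : P) = (Vx 1).1 * (Vx 2).1 := mul_comm _ _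
    have q13 : (X 1 * X 3 : P) = (Vx 1).1 * (Vx 3).1 := rfl
    have q23 : (X 2 * X 3 : P) = (Vx 2).1 * (Vx 3).1 := rfl
    have c21 := mV_comm Φ hp (Vx 2) (Vx 1)
    have c31 := mV_comm Φ hp (Vx 3) (Vx 1)
    have c32 := mV_comm Φ hp (Vx 3) (Vx 2)
    have cc := mV_comm Φ hp
    intro i j
    fin_cases i <;> fin_cases j <;> 
      simp [smMatrix, bV, FV_apply, fyz _ _ _ q13, fyz _ _ _ q12, 
        fw2 _ _ _ q22, fw2 _ _ _ q12, fw2 _ _ _ q21, fw2 _ _ _ q11, fzw _ _ _ q23, fzw _ _ _ q12,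
        fzw _ _ _ q13, fzw _ _ _ q11, fyw _ _ _ q23, fyw _ _ _ q22, fyw _ _ _ q13, fyw _ _ _ q12,
        fz2 _ _ _ q13, fz2 _ _ _ q11, c21, c31, c32]
    all_goals first | exact congrArg _ (cc _ _) | (congr 1 <;> first | rfl | exact congrArg _ (cc _ _)) | skip
  obtain ⟨κ, n, hκ, hn, h⟩ := rank_one_sym _ (fun i j => by rw [hM, hM, FV_symm]) hSM
  exact ⟨mkAD Φ hp κ hκ n hn (fun i j => by rw [← hM, h]), rfl, mV_spec Φ hp, φV_apply Φ⟩

end glue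

section annih
variable {k : Type*} [Field k]
local notation "P" => MvPolynomial (Fin 4) k
local notation "V" => VV k

theorem inj_of_surj {R : Type*} [CommRing R] [IsNoetherianRing R] (f : R →+* R)
    (hf : Function.Surjective f) : Function.Injective f := by
  rw [injective_iff_map_eq_zero]
  intro a ha
  have hmono : Monotone (fun n => RingHom.ker (f ^ n)) := by
    apply monotone_nat_of_le_succ
    intro n x hx
    rw [RingHom.mem_ker] at hx ⊢
    rw [pow_succ', RingHom.mul_def, RingHom.comp_apply, hx, map_zero]
  obtain ⟨n, hn⟩ := monotone_stabilizes_iff_noetherian.2 (inferInstanceAs (IsNoetherian R R)) ⟨_, hmono⟩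
  have hs : Function.Surjective (f ^ n) := by
    rw [RingHom.coe_pow]
    exact hf.iterate n
  obtain ⟨b, rfl⟩ := hs a
  have hb : b ∈ RingHom.ker (f ^ (n+1)) := by
    rw [RingHom.mem_ker, pow_succ', RingHom.mul_def, RingHom.comp_apply, ha]
  have h2 : RingHom.ker (f ^ n) = RingHom.ker (f ^ (n+1)) := hn (n+1) (by omega)
  rwa [← h2, RingHom.mem_ker] at hb

theorem exists_algEquiv (l : Fin 4 → P) (h : ∀ i, X i ∈ (aeval l : P →ₐ[k] P).range) :
    ∃ e : P ≃ₐ[k] P, ∀ i, e (X i) = l i := by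
  have hs : Function.Surjective (aeval l : P →ₐ[k] P) := by
    intro f
    induction f using MvPolynomial.induction_on with
    | C a => exact ⟨C a, by simp⟩
    | add p q hp hq =>
      obtain ⟨a, rfl⟩ := hp
      obtain ⟨b, rfl⟩ := hq
      exact ⟨a + b, map_add _ _ _⟩
    | mul_X p i hp =>
      obtain ⟨a, rfl⟩ := hp
      obtain ⟨b, hb⟩ := h i
      refine ⟨a * b, ?_⟩
      rw [map_mul]
      congr 1
  have hi : Function.Injective (aeval l : P →ₐ[k] P) := by
    exact inj_of_surj (aeval l : P →ₐ[k] P).toRingHom hs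
  exact ⟨AlgEquiv.ofBijective _ ⟨hi, hs⟩, fun i => by simp⟩

variable (Φ : MvPolynomial (Fin 4) k →ₗ[k] k)

theorem Φ_hom
    (hΦ : ∀ m : Fin 4 →₀ ℕ, (m.sum fun _ e => e) ≠ 3 → Φ (monomial m 1) = 0) {f : P} {n : ℕ}
    (hf : f.IsHomogeneous n) (hn : n ≠ 3) : Φ f = 0 := by
  rw [← support_sum_monomial_coeff f, map_sum]
  apply Finset.sum_eq_zero
  intro m hm
  have e : monomial m (coeff m f) = coeff m f • (monomial m 1 : P) := by simp [smul_monomial]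
  rw [e, map_smul, hΦ, smul_zero]
  have := hf (mem_support_iff.1 hm)
  rw [Finsupp.weight_apply] at this
  simp at this
  rwa [this]

theorem ann_of_hom
    (hΦ : ∀ m : Fin 4 →₀ ℕ, (m.sum fun _ e => e) ≠ 3 → Φ (monomial m 1) = 0) {f : P} {n : ℕ}
    (hf : f.IsHomogeneous n) (h : ∀ (g : P) (j : ℕ), n + j = 3 → g.IsHomogeneous j → Φ (f * g) = 0) :
    f ∈ annIdeal k Φ := by
  intro g
  rw [← sum_homogeneousComponent g, Finset.mul_sum, map_sum]
  apply Finset.sum_eq_zero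
  intro j hj
  have hg := homogeneousComponent_isHomogeneous j g
  by_cases hn : n + j = 3
  · exact h _ _ hn hg
  · exact Φ_hom Φ hΦ (hf.mul hg) hn

variable (D : AD k (VV k))

theorem Z_ann 
    (hΦ : ∀ m : Fin 4 →₀ ℕ, (m.sum fun _ e => e) ≠ 3 → Φ (monomial m 1) = 0)
    (hm : ∀ a b v : V, Φ (X 0 * (D.m a b).1 * v.1) = Φ (a.1 * b.1 * v.1)) (a b : V) : 
    a.1 * b.1 - X 0 * (D.m a b).1 ∈ annIdeal k Φ := by
  have ha : a.1.IsHomogeneous 1 := a.2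
  have hb : b.1.IsHomogeneous 1 := b.2
  have hab : (D.m a b).1.IsHomogeneous 1 := (D.m a b).2
  apply ann_of_hom Φ hΦ (n := 2) ((ha.mul hb).sub ((isHomogeneous_X k 0).mul hab))
  intro g j hj hg
  obtain rfl : j = 1 := by omega
  have := hm a b ⟨g, hg⟩
  rw [sub_mul, map_sub, this, sub_self]

theorem x2_ann 
    (hΦ : ∀ m : Fin 4 →₀ ℕ, (m.sum fun _ e => e) ≠ 3 → Φ (monomial m 1) = 0)
    (hφ : ∀ a, D.φ a = Φ (X 0 ^ 2 * a.1)) (a : V) (h0 : D.φ a = 0) : 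
    X 0 ^ 2 * a.1 ∈ annIdeal k Φ := by
  have ha : a.1.IsHomogeneous 1 := a.2
  apply ann_of_hom Φ hΦ (n := 3) (((isHomogeneous_X k 0).pow 2).mul ha)
  intro g j hj hg
  obtain rfl : j = 0 := by omega
  have hg' : g = C (coeff 0 g) := totalDegree_eq_zero_iff_eq_C.1 (Nat.le_zero.1 hg.totalDegree_le)
  rw [hg', mul_comm, ← smul_eq_C_mul, map_smul, ← hφ, h0, smul_zero]

theorem ann_le 
    (hΦ : ∀ m : Fin 4 →₀ ℕ, (m.sum fun _ e => e) ≠ 3 → Φ (monomial m 1) = 0)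
    (hx : D.x.1 = X 0)
    (hm : ∀ a b v : V, Φ (X 0 * (D.m a b).1 * v.1) = Φ (a.1 * b.1 * v.1)) 
    (hφ : ∀ a, D.φ a = Φ (X 0 ^ 2 * a.1)) (K : Ideal P)
    (Z : ∀ a b : V, a.1 * b.1 - X 0 * (D.m a b).1 ∈ K)
    (hM : ∀ a, D.φ a = 0 → X 0 ^ 2 * a.1 ∈ K) 
    (hle : K ≤ annIdeal k Φ) (w : V) (hw : D.φ w ≠ 0) : annIdeal k Φ ≤ K := by
  have hsm : ∀ (f : P) (a : k), f ∈ K → a • f ∈ K := by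
    intro f a hf
    rw [smul_eq_C_mul]; exact K.mul_mem_left _ hf
  -- cubes
  have h3 : ∀ a : V, X 0 ^ 3 * a.1 ∈ K := by
    obtain ⟨m, m0, hm0⟩ : ∃ m : V, m ≠ 0 ∧ D.φ m = 0 := by
      obtain ⟨y, z, hyz⟩ := D.ex
      by_cases h : D.φ z • y - D.φ y • z = 0
      · refine ⟨y, ?_, ?_⟩
        · rintro rfl; simp at hyz
        · have := congrArg (fun a => D.δ a y) h
          simp [D.alt, D.skew z y, hyz] at this
          exact this
      · exact ⟨_, h, by simp; ring⟩
    obtain ⟨a, ha⟩ : ∃ a, D.φ (D.m m a) ≠ 0 := by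
      by_contra! hh
      exact m0 (D.nd m hh)
    have hn : X 0 ^ 3 * (D.m m a).1 ∈ K := by
      have e : X 0 ^ 3 * (D.m m a).1 = a.1 * (X 0 ^ 2 * m.1) - X 0 ^ 2 * (m.1 * a.1 - X 0 * (D.m m a).1) := by ring
      rw [e]
      exact K.sub_mem (K.mul_mem_left _ (hM m hm0)) (K.mul_mem_left _ (Z _ _))
    intro v
    generalize D.m m a = n at *
    have hv := hM (v - (D.φ v / D.φ n) • n) (by simp; field_simp; ring)
    have e : X 0 ^ 3 * v.1 = X 0 * (X 0 ^ 2 * (v - (D.φ v / D.φ n) • n).1) + (D.φ v / D.φ n) • (X 0 ^ 3 * n.1) := by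
      simp only [Submodule.coe_sub, Submodule.coe_smul, smul_eq_C_mul]; ring
    rw [e]
    exact K.add_mem (K.mul_mem_left _ hv) (hsm _ _ hn)
  -- squares
  have h2 : ∀ v : V, X 0 ^ 2 * v.1 - C (D.φ v / D.φ w) * (X 0 ^ 2 * w.1) ∈ K := by
    intro v
    have hv := hM (v - (D.φ v / D.φ w) • w) (by simp; field_simp; ring)
    convert hv using 1
    simp only [Submodule.coe_sub, Submodule.coe_smul, smul_eq_C_mul]; ring
  have red : ∀ f : P, ∃ (a : k) (l l' : V) (t : k), 
      f - (C a + l.1 + X 0 * l'.1 + C t * (X 0 ^ 2 * w.1)) ∈ K := by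
    intro f
    induction f using MvPolynomial.induction_on with
    | C a => exact ⟨a, 0, 0, 0, by simp⟩
    | add p q hp hq =>
      obtain ⟨a, l, l', t, h⟩ := hp
      obtain ⟨b, m, m', s, h'⟩ := hq
      refine ⟨a + b, l + m, l' + m', t + s, ?_⟩
      convert K.add_mem h h' using 1
      simp only [Submodule.coe_add, map_add]; ring
    | mul_X p i hp =>
      obtain ⟨a, l, l', t, h⟩ := hp
      refine ⟨0, a • Vx i, D.m l (Vx i), D.φ (D.m l' (Vx i)) / D.φ w, ?_⟩
      have e : ∀ i, (Vx i : V).1 = X i := fun i => rfl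
      have := K.add_mem (K.add_mem (K.add_mem (K.mul_mem_right (X i) h) (Z l (Vx i))) 
        (K.add_mem (K.mul_mem_left (X 0) (Z l' (Vx i))) (h2 (D.m l' (Vx i)))))
        (K.add_mem (K.mul_mem_left (C t * X 0 ^ 2) (Z w (Vx i))) (K.mul_mem_left (C t) (h3 (D.m w (Vx i)))))
      convert this using 1
      simp only [Submodule.coe_smul, e, map_zero, smul_eq_C_mul]; ring
  intro f hf
  obtain ⟨a, l, l', t, h⟩ := red f
  have hr := (annIdeal k Φ).sub_mem hf (hle h)
  rw [sub_sub_cancel] at hr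
  have hl : l.1.IsHomogeneous 1 := l.2
  have hl' : l'.1.IsHomogeneous 1 := l'.2
  have hw' : w.1.IsHomogeneous 1 := w.2
  have hX := isHomogeneous_X k (0 : Fin 4)
  have z4 := fun f hf => Φ_hom Φ hΦ (f := f) (n := 4) hf (by norm_num)
  have z5 := fun f hf => Φ_hom Φ hΦ (f := f) (n := 5) hf (by norm_num)
  have z6 := fun f hf => Φ_hom Φ hΦ (f := f) (n := 6) hf (by norm_num)
  have z2 := fun f hf => Φ_hom Φ hΦ (f := f) (n := 2) hf (by norm_num)
  have z1 := fun f hf => Φ_hom Φ hΦ (f := f) (n := 1) hf (by norm_num)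
  have hsm' : ∀ (a : k) (f : P), Φ (C a * f) = a * Φ f := by
    intro a f; rw [← smul_eq_C_mul, map_smul, smul_eq_mul]
  have ha : a = 0 := by
    have := hr (X 0 ^ 2 * w.1)
    rw [show (C a + l.1 + X 0 * l'.1 + C t * (X 0 ^ 2 * w.1)) * (X 0 ^ 2 * w.1) =
      C a * (X 0 ^ 2 * w.1) + l.1 * (X 0 ^ 2 * w.1) + X 0 * l'.1 * (X 0 ^ 2 * w.1) + C t * ((X 0 ^ 2 * w.1) * (X 0 ^ 2 * w.1)) by ring,
      map_add, map_add, map_add, hsm', hsm', z4 _ (hl.mul ((hX.pow 2).mul hw')), z5 _ ((hX.mul hl').mul ((hX.pow 2).mul hw')),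
      z6 _ (((hX.pow 2).mul hw').mul ((hX.pow 2).mul hw')), ← hφ] at this
    simpa [hw] using this
  subst ha
  have φm : ∀ a b, D.φ (D.m a b) = Φ (X 0 * a.1 * b.1) := by
    intro a b
    have := hm a b D.x
    rw [hx] at this
    rw [hφ, show X 0 * a.1 * b.1 = a.1 * b.1 * X 0 by ring, ← this]
    congr 1; ring
  have hl0 : l = 0 := by
    apply D.nd
    intro v
    have hv : v.1.IsHomogeneous 1 := v.2
    have := hr (X 0 * v.1)
    rw [show (C 0 + l.1 + X 0 * l'.1 + C t * (X 0 ^ 2 * w.1)) * (X 0 * v.1) =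
      X 0 * l.1 * v.1 + X 0 * l'.1 * (X 0 * v.1) + C t * ((X 0 ^ 2 * w.1) * (X 0 * v.1)) by rw [map_zero]; ring,
      map_add, map_add, hsm', z4 _ ((hX.mul hl').mul (hX.mul hv)), 
      z5 _ (((hX.pow 2).mul hw').mul (hX.mul hv)), ← φm] at this
    simpa using this
  subst hl0
  have hl0 : l' = 0 := by
    apply D.nd
    intro v
    have hv : v.1.IsHomogeneous 1 := v.2
    have := hr v.1
    rw [show (C 0 + (0 : V).1 + X 0 * l'.1 + C t * (X 0 ^ 2 * w.1)) * v.1 =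
      X 0 * l'.1 * v.1 + C t * ((X 0 ^ 2 * w.1) * v.1) by rw [map_zero, Submodule.coe_zero]; ring,
      map_add, hsm', z4 _ (((hX.pow 2).mul hw').mul hv), ← φm] at this
    simpa using this
  subst hl0
  have ht : t = 0 := by
    have := hr 1
    rw [show (C 0 + (0 : V).1 + X 0 * (0 : V).1 + C t * (X 0 ^ 2 * w.1)) * 1 =
      C t * (X 0 ^ 2 * w.1) by rw [map_zero, Submodule.coe_zero]; ring,
      hsm', ← hφ] at this
    simpa [hw] using this
  subst ht
  simpa using h
end annih

section final
variable {k : Type*} [Field k]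
local notation "P" => MvPolynomial (Fin 4) k
local notation "V" => VV k

theorem exists_frame (D : AD k (VV k)) {x y z w : V}
    (h : ∀ v, ∃ a b c d : k, v = a • x + b • y + c • z + d • w) :
    ∃ e : P ≃ₐ[k] P, e (X 0) = x.1 ∧ e (X 1) = y.1 ∧ e (X 2) = z.1 ∧ e (X 3) = w.1 := by
  obtain ⟨e, he⟩ := exists_algEquiv (k := k) ![x.1, y.1, z.1, w.1] (by
    intro i
    obtain ⟨a, b, c, d, hh⟩ := h (Vx i)
    have h2 := congrArg Subtype.val hh
    refine ⟨a • X 0 + b • X 1 + c • X 2 + d • X 3, ?_⟩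
    have e : ∀ i, (Vx i : V).1 = X i := fun i => rfl
    rw [← e i, h2]
    simp)
  exact ⟨e, by simp [he], by simp [he], by simp [he], by simp [he]⟩

theorem ann_eq (Φ : MvPolynomial (Fin 4) k →ₗ[k] k) (D : AD k (VV k))
    (hΦ : ∀ m : Fin 4 →₀ ℕ, (m.sum fun _ e => e) ≠ 3 → Φ (monomial m 1) = 0)
    (hx : D.x.1 = X 0)
    (hm : ∀ a b v : V, Φ (X 0 * (D.m a b).1 * v.1) = Φ (a.1 * b.1 * v.1)) 
    (hφ : ∀ a, D.φ a = Φ (X 0 ^ 2 * a.1)) 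
    {w y z v a0 a1 a2 : V} {τ l : k} (F : AD.Fr D w τ) (hy : D.m w y = 0) (hz : D.m w z = 0)
    (hyz : D.δ y z ≠ 0) (hs : ∀ v, D.m w v = 0 → ∃ a, D.m y a = v)
    (hv : v = z + (w - τ • D.x))
    (e1 : D.m y a1 = - z) (e2 : D.m y a2 = - v) (e0 : D.m y a0 = - D.m z v)
    (hc : D.φ (l • w - a0 + D.m z a2) = 0) (K : Ideal P)
    (hK : K = Ideal.span {w.1*y.1, w.1*z.1, z.1*v.1+y.1*a0.1, z.1*X 0+y.1*a1.1,
          -a0.1 * X 0^2 + z.1*X 0*a2.1 + v.1*X 0*a1.1 + y.1*a1.1*a2.1 + w.1*(C l * X 0 ^ 2 + (v.1 - z.1)^2)} ⊔ 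
          Ideal.span {w.1*y.1, w.1*v.1, z.1*v.1+y.1*a0.1, v.1*X 0+y.1*a2.1,
          -a0.1 * X 0^2 + z.1*X 0*a2.1 + v.1*X 0*a1.1 + y.1*a1.1*a2.1 + w.1*(C l * X 0 ^ 2 + (v.1 - z.1)^2)}) :
    annIdeal k Φ = K := by
  have wv : D.m w v = 0 := by rw [hv, map_add, hz, F.wh, add_zero]
  have eC : (l • w - a0 + D.m z a2).1 = C l * w.1 - a0.1 + (D.m z a2).1 := by
    simp [smul_eq_C_mul]
  have hle : K ≤ annIdeal k Φ := by
    have A := Z_ann Φ D hΦ hm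
    have k1 : w.1*y.1 ∈ annIdeal k Φ := by simpa [hy] using A w y
    have k2 : w.1*z.1 ∈ annIdeal k Φ := by simpa [hz] using A w z
    have k6 : w.1*v.1 ∈ annIdeal k Φ := by simpa [wv] using A w v
    have k3 : z.1*v.1+y.1*a0.1 ∈ annIdeal k Φ := by
      convert (annIdeal k Φ).add_mem (A z v) (A y a0) using 1
      rw [e0]; simp
    have k4 : z.1*X 0+y.1*a1.1 ∈ annIdeal k Φ := by
      convert A y a1 using 1
      rw [e1]; simp; ring
    have k7 : v.1*X 0+y.1*a2.1 ∈ annIdeal k Φ := by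
      convert A y a2 using 1
      rw [e2]; simp; ring
    have k5 : -a0.1 * X 0^2 + z.1*X 0*a2.1 + v.1*X 0*a1.1 + y.1*a1.1*a2.1 + w.1*(C l * X 0 ^ 2 + (v.1 - z.1)^2) ∈ annIdeal k Φ := by
      have h := x2_ann Φ D hΦ hφ _ hc
      rw [eC] at h
      convert (annIdeal k Φ).add_mem h ((annIdeal k Φ).add_mem ((annIdeal k Φ).add_mem 
        ((annIdeal k Φ).mul_mem_left (X 0) (A z a2)) ((annIdeal k Φ).mul_mem_left a1.1 k7)) 
        ((annIdeal k Φ).mul_mem_left (v.1 - z.1) ((annIdeal k Φ).sub_mem k6 k2))) using 1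
      ring
    rw [hK]
    refine sup_le (Ideal.span_le.2 ?_) (Ideal.span_le.2 ?_)
    · rintro f (rfl | rfl | rfl | rfl | rfl) <;> assumption
    · rintro f (rfl | rfl | rfl | rfl | rfl) <;> assumption
  apply le_antisymm
  · have k1 : w.1*y.1 ∈ K := hK ▸ Ideal.mem_sup_left (Ideal.subset_span (by simp))
    have k2 : w.1*z.1 ∈ K := hK ▸ Ideal.mem_sup_left (Ideal.subset_span (by simp))
    have k3 : z.1*v.1+y.1*a0.1 ∈ K := hK ▸ Ideal.mem_sup_left (Ideal.subset_span (by simp))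
    have k4 : z.1*X 0+y.1*a1.1 ∈ K := hK ▸ Ideal.mem_sup_left (Ideal.subset_span (by simp))
    have k5 : -a0.1 * X 0^2 + z.1*X 0*a2.1 + v.1*X 0*a1.1 + y.1*a1.1*a2.1 + w.1*(C l * X 0 ^ 2 + (v.1 - z.1)^2) ∈ K := 
      hK ▸ Ideal.mem_sup_left (Ideal.subset_span (by simp))
    have k6 : w.1*v.1 ∈ K := hK ▸ Ideal.mem_sup_right (Ideal.subset_span (by simp))
    have k7 : v.1*X 0+y.1*a2.1 ∈ K := hK ▸ Ideal.mem_sup_right (Ideal.subset_span (by simp))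
    clear hK
    have ev : v.1 = z.1 + (w.1 - C τ * X 0) := by rw [hv]; simp [hx, smul_eq_C_mul]
    have Zc : ∀ a b : V, a.1 * b.1 - X 0 * (D.m a b).1 ∈ K → b.1 * a.1 - X 0 * (D.m b a).1 ∈ K := by
      intro a b h
      rwa [mul_comm b.1, D.comm b]
    have Zl : ∀ a b1 b2 b3 b4 : V, a.1 * b1.1 - X 0 * (D.m a b1).1 ∈ K → 
        a.1 * b2.1 - X 0 * (D.m a b2).1 ∈ K → a.1 * b3.1 - X 0 * (D.m a b3).1 ∈ K → 
        a.1 * b4.1 - X 0 * (D.m a b4).1 ∈ K → ∀ s1 s2 s3 s4 : k, 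
        a.1 * (s1 • b1 + s2 • b2 + s3 • b3 + s4 • b4).1 - 
          X 0 * (D.m a (s1 • b1 + s2 • b2 + s3 • b3 + s4 • b4)).1 ∈ K := by
      intro a b1 b2 b3 b4 h1 h2 h3 h4 s1 s2 s3 s4
      convert K.add_mem (K.add_mem (K.add_mem (K.mul_mem_left (C s1) h1) (K.mul_mem_left (C s2) h2))
        (K.mul_mem_left (C s3) h3)) (K.mul_mem_left (C s4) h4) using 1
      simp only [map_add, map_smul, Submodule.coe_add, Submodule.coe_smul, smul_eq_C_mul]
      ring
    have Zx : ∀ a : V, a.1 * D.x.1 - X 0 * (D.m a D.x).1 ∈ K := by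
      intro a
      rw [D.one', hx, mul_comm, sub_self]; exact K.zero_mem
    have Zwy : w.1 * y.1 - X 0 * (D.m w y).1 ∈ K := by rw [hy]; simpa using k1
    have Zwz : w.1 * z.1 - X 0 * (D.m w z).1 ∈ K := by rw [hz]; simpa using k2
    have Zww : w.1 * w.1 - X 0 * (D.m w w).1 ∈ K := by
      rw [F.ww]
      convert K.sub_mem k6 k2 using 1
      rw [ev]
      simp only [Submodule.coe_smul, smul_eq_C_mul]
      ring
    have Zya1 : y.1 * a1.1 - X 0 * (D.m y a1).1 ∈ K := by
      rw [e1]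
      convert k4 using 1
      simp; ring
    have Zya2 : y.1 * a2.1 - X 0 * (D.m y a2).1 ∈ K := by
      rw [e2]
      convert k7 using 1
      simp; ring
    have Zy : ∀ b : V, y.1 * b.1 - X 0 * (D.m y b).1 ∈ K := by
      intro b
      obtain ⟨s1, s2, s3, s4, rfl⟩ := F.spanning hyz hy hz hs e1 (by rw [e2, hv]) b
      exact Zl _ _ _ _ _ (Zx y) Zya1 Zya2 (Zc _ _ Zwy) _ _ _ _
    have Zw : ∀ b : V, w.1 * b.1 - X 0 * (D.m w b).1 ∈ K := by
      intro b
      obtain ⟨s1, s2, s3, s4, rfl⟩ := F.dec4 hyz b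
      exact Zl _ _ _ _ _ (Zx w) Zwy Zwz Zww _ _ _ _
    have Zzz : z.1 * z.1 - X 0 * (D.m z z).1 ∈ K := by
      have h0 := Zy a0
      rw [e0] at h0
      have h1 : z.1 * v.1 - X 0 * (D.m z v).1 ∈ K := by
        convert K.sub_mem k3 h0 using 1
        simp; ring
      convert K.sub_mem h1 (Zc _ _ Zwz) using 1
      rw [ev, hv]
      simp only [map_add, map_sub, map_smul, D.one', Submodule.coe_add, Submodule.coe_sub, Submodule.coe_smul, smul_eq_C_mul]
      ring
    have Zz : ∀ b : V, z.1 * b.1 - X 0 * (D.m z b).1 ∈ K := by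
      intro b
      obtain ⟨s1, s2, s3, s4, rfl⟩ := F.dec4 hyz b
      exact Zl _ _ _ _ _ (Zx z) (Zc _ _ (Zy z)) Zzz (Zc _ _ Zwz) _ _ _ _
    have Z : ∀ a b : V, a.1 * b.1 - X 0 * (D.m a b).1 ∈ K := by
      intro a b
      obtain ⟨s1, s2, s3, s4, rfl⟩ := F.dec4 hyz b
      exact Zl _ _ _ _ _ (Zx a) (Zc _ _ (Zy a)) (Zc _ _ (Zz a)) (Zc _ _ (Zw a)) _ _ _ _
    let M : Submodule k (VV k) :=
      { carrier := {a | X 0 ^ 2 * a.1 ∈ K}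
        add_mem' := by
          intro a b ha hb
          simp only [Set.mem_setOf_eq, Submodule.coe_add, mul_add] at *
          exact K.add_mem ha hb
        zero_mem' := by simp
        smul_mem' := by
          intro c a ha
          simp only [Set.mem_setOf_eq, Submodule.coe_smul, smul_eq_C_mul] at *
          rw [mul_left_comm]
          exact K.mul_mem_left _ ha }
    have hM : ∀ a, a ∈ M ↔ X 0 ^ 2 * a.1 ∈ K := fun a => Iff.rfl
    have hker := F.kerφ hyz hy (by rw [e2, hv]) (by rw [e0, hv]) rfl hc M (by
      intro a b c
      rw [hM]
      convert K.sub_mem (K.add_mem (K.mul_mem_left (X 0) (Z a (D.m b c))) (K.mul_mem_left a.1 (Z b c)))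
        (K.add_mem (K.mul_mem_left (X 0) (Z (D.m a b) c)) (K.mul_mem_left c.1 (Z a b))) using 1
      simp only [Submodule.coe_sub]
      ring) (by
      rw [hM, eC]
      convert K.sub_mem k5 (K.add_mem (K.add_mem (K.mul_mem_left (X 0) (Z z a2)) (K.mul_mem_left a1.1 k7)) 
        (K.mul_mem_left (v.1 - z.1) (K.sub_mem k6 k2))) using 1
      ring)
    refine ann_le Φ D hΦ hx hm hφ K Z hker hle w F.φw
  · exact hle
end final

/-- **Theorem 12.1.**  Assume `Φ` is a degree-3 Macaulay inverse system on
`P = k[x,y,z,w]` whose annihilator contains no nonzero linear form, `p` is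
bijective, and the symmetric matrix `SM` has rank exactly one.  Then `ann Φ`
is the sum of two linked grade-three perfect ideals. -/
theorem annIdeal_sum_of_linked_of_rank_smMatrix_eq_one
    (Φ : MvPolynomial (Fin 4) k →ₗ[k] k)
    (hΦ : ∀ m : Fin 4 →₀ ℕ, (m.sum fun _ e => e) ≠ 3 → Φ (monomial m 1) = 0)
    (hlin : ∀ u ∈ homogeneousSubmodule (Fin 4) k 1, u ∈ annIdeal k Φ → u = 0)
    (hp : Function.Bijective (pMap k Φ))
    (ly2 lyz lyw lz2 lzw lw2 : MvPolynomial (Fin 4) k)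
    (hly2m : ly2 ∈ homogeneousSubmodule (Fin 4) k 1)
    (hlyzm : lyz ∈ homogeneousSubmodule (Fin 4) k 1)
    (hlywm : lyw ∈ homogeneousSubmodule (Fin 4) k 1)
    (hlz2m : lz2 ∈ homogeneousSubmodule (Fin 4) k 1)
    (hlzwm : lzw ∈ homogeneousSubmodule (Fin 4) k 1)
    (hlw2m : lw2 ∈ homogeneousSubmodule (Fin 4) k 1)
    (hly2 : ∀ v ∈ homogeneousSubmodule (Fin 4) k 1,
      Φ (X 0 * ly2 * v) = Φ (X 1 ^ 2 * v))
    (hlyz : ∀ v ∈ homogeneousSubmodule (Fin 4) k 1,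
      Φ (X 0 * lyz * v) = Φ (X 1 * X 2 * v))
    (hlyw : ∀ v ∈ homogeneousSubmodule (Fin 4) k 1,
      Φ (X 0 * lyw * v) = Φ (X 1 * X 3 * v))
    (hlz2 : ∀ v ∈ homogeneousSubmodule (Fin 4) k 1,
      Φ (X 0 * lz2 * v) = Φ (X 2 ^ 2 * v))
    (hlzw : ∀ v ∈ homogeneousSubmodule (Fin 4) k 1,
      Φ (X 0 * lzw * v) = Φ (X 2 * X 3 * v))
    (hlw2 : ∀ v ∈ homogeneousSubmodule (Fin 4) k 1,
      Φ (X 0 * lw2 * v) = Φ (X 3 ^ 2 * v))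
    (hSM : (smMatrix k Φ ly2 lyz lyw lz2 lzw lw2).rank = 1) :
    ∃ (I₁ I₂ : Ideal (MvPolynomial (Fin 4) k)) (a₁ a₂ a₃ : MvPolynomial (Fin 4) k),
      a₁ ∈ I₁ ⊓ I₂ ∧ a₂ ∈ I₁ ⊓ I₂ ∧ a₃ ∈ I₁ ⊓ I₂ ∧
        RingTheory.Sequence.IsRegular (MvPolynomial (Fin 4) k) [a₁, a₂, a₃] ∧
        (Ideal.span {a₁, a₂, a₃}).colon I₁ = I₂ ∧
        (Ideal.span {a₁, a₂, a₃}).colon I₂ = I₁ ∧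
        annIdeal k Φ = I₁ + I₂ ∧
        HasLengthThreeFreeResolution I₁ ∧ HasLengthThreeFreeResolution I₂ := by
  obtain ⟨D, hx, hm, hφ⟩ := exists_AD Φ hp ly2 lyz lyw lz2 lzw lw2 hlyzm hlywm hlz2m hlzwm hlw2m
    hlyz hlyw hlz2 hlzw hlw2 hSM
  obtain ⟨w, τ, y, z, F, hy, hz, hyz, hs⟩ := AD.exists_good D
  obtain ⟨v, hv⟩ : ∃ v, v = z + (w - τ • D.x) := ⟨_, rfl⟩
  have wv : D.m w v = 0 := by rw [hv, map_add, hz, F.wh, add_zero]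
  obtain ⟨a1, e1⟩ := hs (-z) (by rw [map_neg, hz, neg_zero])
  obtain ⟨a2, e2⟩ := hs (-v) (by rw [map_neg, wv, neg_zero])
  obtain ⟨a0, e0⟩ := hs (- D.m z v) (by rw [map_neg, F.mem_mul hz, neg_zero])
  obtain ⟨l, hl⟩ : ∃ l : k, D.φ (l • w - a0 + D.m z a2) = 0 := by
    have := F.φw
    refine ⟨(D.φ a0 - D.φ (D.m z a2)) / D.φ w, ?_⟩
    simp
    field_simp
    ring
  have hyv : D.δ y v ≠ 0 := by
    rw [hv]
    simpa [D.δx', D.skew y w, F.hδ] using hyz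
  have ev : v.1 = z.1 - C τ * X 0 + C 1 * w.1 := by
    rw [hv]; simp [hx, smul_eq_C_mul]; ring
  have ev2 : z.1 = v.1 - C (-τ) * X 0 + C (-1) * w.1 := by
    rw [ev]; simp only [map_neg, map_one]; ring
  have zw : D.m z w = 0 := by rw [D.comm, hz]
  have vw : D.m v w = 0 := by rw [D.comm, wv]
  have cc : ∀ {a b c d : k} {p u : VV k}, p = a • D.x + b • y + c • u + d • w → 
      p.1 = C a * X 0 + C b * y.1 + C c * u.1 + C d * w.1 := by
    rintro a b c d p u rfl
    simp [hx, smul_eq_C_mul]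
  have H1 : Half w.1 y.1 z.1 v.1 (X 0) a0.1 a1.1 a2.1 (C l * X 0 ^ 2 + (v.1 - z.1) ^ 2) := by
    obtain ⟨e, q0, q1, q2, q3⟩ := exists_frame D (F.dec4 hyz)
    obtain ⟨α0, α1, α2, α3, hα⟩ := F.dec4 hyz a0
    obtain ⟨β0, β1, β2, β3, hβ⟩ := F.dec4 hyz a1
    refine half_of e one_ne_zero (q0.trans hx) q1 q2 q3 ev (cc hα) (cc hβ) rfl
      (AD.Fr.hN hy hyz hz (by rw [e1]; simp) ?_ hα hβ)
    rw [e0, hv]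
    simp only [map_add, map_sub, map_smul, D.one', zw]
    module
  have H2 : Half w.1 y.1 v.1 z.1 (X 0) a0.1 a2.1 a1.1 (C l * X 0 ^ 2 + (v.1 - z.1) ^ 2) := by
    obtain ⟨e, q0, q1, q2, q3⟩ := exists_frame D (F.dec4 hyv)
    obtain ⟨α0, α1, α2, α3, hα⟩ := F.dec4 hyv a0
    obtain ⟨β0, β1, β2, β3, hβ⟩ := F.dec4 hyv a2
    refine half_of e (neg_ne_zero.2 one_ne_zero) (q0.trans hx) q1 q2 q3 ev2 (cc hα) (cc hβ) (lam := l) (by ring)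
      (AD.Fr.hN hy hyv wv (by rw [e2]; simp) ?_ hα hβ)
    rw [e0]
    have ez : z = v - w + τ • D.x := by rw [hv]; module
    rw [ez]
    simp only [map_add, map_sub, map_smul, LinearMap.add_apply, LinearMap.sub_apply, LinearMap.smul_apply, D.one, wv]
    module
  obtain ⟨I₁, I₂, b₁, b₂, b₃, h1, h2, h3, h4, h5, h6, h7, h8, h9⟩ := core_main H1 H2
  exact ⟨I₁, I₂, b₁, b₂, b₃, h1, h2, h3, h4, h5, h6, 
    ann_eq Φ D hΦ hx hm hφ F hy hz hyz hs hv e1 e2 e0 hl _ h7, h8, h9⟩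

end
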